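/- arXiv:1502.02393 — 4 statements merged into one kernel-verified Lean document; each statement's English description precedes it below -/
import Mathlib

section
/- Every multiarrangement of rank at most 2 is free: if (A, ν) is a multiarrangement in K^2 (or more generally the common intersection of its hyperplanes has codimension at most 2), then D(A, ν) is a free S-module of rank equal to the dimension of the ambient space. -/
open MvPolynomial

/-- The linear form `∑ αᵢ xᵢ` as a polynomial. -/
noncomputable def lin {K : Type} [Field K] {ℓ : ℕ} (α : Fin ℓ → K) :
    MvPolynomial (Fin ℓ) K :=
  ∑ i, C (α i) * X i

/-- The value of the derivation `∑ fᵢ ∂/∂xᵢ` on the linear form `∑ αᵢ xᵢ`. -/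
noncomputable def derAp {K : Type} [Field K] {ℓ : ℕ}
    (f : Fin ℓ → MvPolynomial (Fin ℓ) K) (α : Fin ℓ → K) : MvPolynomial (Fin ℓ) K :=
  ∑ i, C (α i) * f i

/-- Membership in `D(A,ν)` for the multiarrangement with hyperplanes `ker(α i)` of
multiplicity `ν i`. -/
def memD {K : Type} [Field K] {ℓ : ℕ} {I : Type} [Fintype I]
    (α : I → Fin ℓ → K) (ν : I → ℕ) (f : Fin ℓ → MvPolynomial (Fin ℓ) K) : Prop :=
  ∀ i, lin (α i) ^ ν i ∣ derAp f (α i)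

/-- `θ` is an `S`-basis of the set `D`. -/
def isBasisOf {K : Type} [Field K] {ℓ n : ℕ}
    (D : (Fin ℓ → MvPolynomial (Fin ℓ) K) → Prop)
    (θ : Fin n → Fin ℓ → MvPolynomial (Fin ℓ) K) : Prop :=
  (∀ j, D (θ j)) ∧
    ∀ g, D g → ∃! c : Fin n → MvPolynomial (Fin ℓ) K, g = ∑ j, c j • θ j

/-- The derivation `∑ f i ∂/∂x i` is homogeneous of polynomial degree `p`. -/
def homogOf {K : Type} [Field K] {ℓ : ℕ}
    (f : Fin ℓ → MvPolynomial (Fin ℓ) K) (p : ℕ) : Prop :=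
  ∀ i, f i = 0 ∨ (f i).IsHomogeneous p

lemma pid_basis {R : Type*} [CommRing R] [IsDomain R] [IsPrincipalIdealRing R] {n : ℕ} (k0 : Fin n)
    (f : (Fin n → R) →ₗ[R] R) :
    ∃ (b : Module.Basis (Fin n) R (Fin n → R)) (i0 : Fin n), ∀ j, j ≠ i0 → f (b j) = 0 := by
  obtain ⟨s, hs⟩ := Module.projective_lifting_property f.rangeRestrict LinearMap.id
    f.surjective_rangeRestrict
  have hs' : ∀ y, f.rangeRestrict (s y) = y := fun y => LinearMap.congr_fun hs y
  let e : (LinearMap.ker f × LinearMap.range f) ≃ₗ[R] (Fin n → R) :=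
    LinearEquiv.ofBijective (LinearMap.coprod (LinearMap.ker f).subtype s) (by
      constructor
      · rw [← LinearMap.ker_eq_bot, LinearMap.ker_eq_bot']
        rintro ⟨x, y⟩ h
        simp only [LinearMap.coprod_apply, Submodule.subtype_apply] at h
        have h2 : y = 0 := by
          have := congrArg f.rangeRestrict h
          rw [map_add, hs', map_zero] at this
          have hx : f.rangeRestrict (x : Fin n → R) = 0 := by
            ext; simp
          simpa [hx] using this
        subst h2
        simpa using h
      · intro v
        refine ⟨(⟨v - s (f.rangeRestrict v), ?_⟩, f.rangeRestrict v), by simp⟩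
        have := congrArg Subtype.val (hs' (f.rangeRestrict v))
        change f (s (f.rangeRestrict v)) = f v at this
        simp [this])
  let bk := Module.finBasis R (LinearMap.ker f)
  let br := Module.finBasis R (LinearMap.range f)
  have hr : Module.finrank R (LinearMap.range f) ≤ 1 := by
    simpa using Submodule.finrank_le (LinearMap.range f)
  let b0 := (bk.prod br).map e
  let σ : _ ≃ Fin n := b0.indexEquiv (Pi.basisFun R (Fin n))
  have key : ∃ i0 : Fin n, ∀ k, σ (Sum.inr k) = i0 := by
    by_cases h : Nonempty (Fin (Module.finrank R (LinearMap.range f)))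
    · obtain ⟨k⟩ := h
      refine ⟨σ (Sum.inr k), fun k' => ?_⟩
      congr 2
      ext; omega
    · exact ⟨k0, fun k => (h ⟨k⟩).elim⟩
  obtain ⟨i0, hi0⟩ := key
  refine ⟨b0.reindex σ, i0, fun j hj => ?_⟩
  rw [Module.Basis.reindex_apply]
  obtain ⟨x, rfl⟩ := σ.surjective j
  rw [Equiv.symm_apply_apply]
  rcases x with x | x
  · have : b0 (Sum.inl x) = (bk x : Fin n → R) := by
      have h : b0 (Sum.inl x) = (LinearMap.coprod (LinearMap.ker f).subtype s)
          ((bk.prod br) (Sum.inl x)) := rfl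
      rw [h]
      simp
    rw [this]; exact (bk x).2
  · exact (hj (hi0 x)).elim

section helpers
variable {K : Type} [Field K] {ℓ : ℕ}

lemma lin_eq (v : Fin ℓ → K) :
    lin v = Fintype.linearCombination K (X : Fin ℓ → MvPolynomial (Fin ℓ) K) v := by
  simp [lin, Fintype.linearCombination_apply, MvPolynomial.smul_eq_C_mul]

lemma lin_add (v w : Fin ℓ → K) : lin (v + w) = lin v + lin w := by simp [lin_eq]
lemma lin_sub (v w : Fin ℓ → K) : lin (v - w) = lin v - lin w := by simp [lin_eq]
lemma lin_smul (c : K) (w : Fin ℓ → K) : lin (c • w) = C c * lin w := by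
  simp [lin_eq, MvPolynomial.smul_eq_C_mul]
lemma lin_single (i : Fin ℓ) : lin (Pi.single i (1 : K)) = X i := by
  simp [lin_eq]

lemma lin_ne_zero {v : Fin ℓ → K} (hv : v ≠ 0) : lin v ≠ 0 := by
  intro h
  apply hv
  ext i
  have := congrArg (MvPolynomial.eval (Pi.single i (1 : K))) h
  simpa [lin, Pi.single_apply] using this

lemma derAp_smul (c : MvPolynomial (Fin ℓ) K) (f : Fin ℓ → MvPolynomial (Fin ℓ) K)
    (a : Fin ℓ → K) : derAp (c • f) a = c * derAp f a := by
  simp only [derAp, Finset.mul_sum, Pi.smul_apply, smul_eq_mul]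
  exact Finset.sum_congr rfl fun i _ => by ring

lemma derAp_sum {J : Type*} (s : Finset J) (f : J → Fin ℓ → MvPolynomial (Fin ℓ) K)
    (a : Fin ℓ → K) : derAp (∑ j ∈ s, f j) a = ∑ j ∈ s, derAp (f j) a := by
  simp only [derAp, Finset.sum_apply, Finset.mul_sum]
  exact Finset.sum_comm

lemma derAp_comb {J : Type*} (s : Finset J) (c : J → MvPolynomial (Fin ℓ) K)
    (f : J → Fin ℓ → MvPolynomial (Fin ℓ) K)
    (a : Fin ℓ → K) : derAp (∑ j ∈ s, c j • f j) a = ∑ j ∈ s, c j * derAp (f j) a := by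
  simp [derAp_sum, derAp_smul]

/-- Substitution homomorphism induced by a linear map. -/
noncomputable def hat (L : (Fin ℓ → K) →ₗ[K] (Fin ℓ → K)) :
    MvPolynomial (Fin ℓ) K →ₐ[K] MvPolynomial (Fin ℓ) K :=
  aeval fun i => lin (L (Pi.single i 1))

lemma hat_lin (L : (Fin ℓ → K) →ₗ[K] (Fin ℓ → K)) (v : Fin ℓ → K) :
    hat L (lin v) = lin (L v) := by
  have h : ((hat L).toLinearMap ∘ₗ
        Fintype.linearCombination K (X : Fin ℓ → MvPolynomial (Fin ℓ) K)) =
      Fintype.linearCombination K (X : Fin ℓ → MvPolynomial (Fin ℓ) K) ∘ₗ L := by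
    apply LinearMap.pi_ext'
    intro i
    ext1
    simp only [LinearMap.comp_apply, LinearMap.single_apply, ← lin_eq, AlgHom.toLinearMap_apply]
    rw [lin_single]
    simp [hat]
  have := LinearMap.congr_fun h v
  simpa [← lin_eq] using this

lemma dvd_sub_hat (L : (Fin ℓ → K) →ₗ[K] (Fin ℓ → K)) (q : MvPolynomial (Fin ℓ) K)
    (h : ∀ v, q ∣ lin v - lin (L v)) (p : MvPolynomial (Fin ℓ) K) : q ∣ p - hat L p := by
  induction p using MvPolynomial.induction_on with
  | C a =>
    have : hat L (C a) = C a := (hat L).commutes a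
    simp [this]
  | add p r hp hr =>
    have := dvd_add hp hr
    rw [map_add]
    convert this using 1
    ring
  | mul_X p i hp =>
    have h1 := h (Pi.single i 1)
    rw [← hat_lin, lin_single] at h1
    have := dvd_add (hp.mul_right (X i)) (h1.mul_left (hat L p))
    rw [map_mul]
    convert this using 1
    ring

lemma basis_change {D : (Fin ℓ → MvPolynomial (Fin ℓ) K) → Prop}
    {θ : Fin ℓ → Fin ℓ → MvPolynomial (Fin ℓ) K} (hθ : isBasisOf D θ)
    (M M' : Matrix (Fin ℓ) (Fin ℓ) (MvPolynomial (Fin ℓ) K)) (h1 : M * M' = 1)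
    (hD : ∀ j, D (∑ k, M j k • θ k)) :
    isBasisOf D fun j => ∑ k, M j k • θ k := by
  have h2 : M' * M = 1 := mul_eq_one_comm.mp h1
  have key : ∀ c : Fin ℓ → MvPolynomial (Fin ℓ) K,
      ∑ j, c j • ∑ k, M j k • θ k = ∑ k, (Matrix.vecMul c M) k • θ k := by
    intro c
    simp only [Matrix.vecMul, dotProduct, Finset.sum_smul, Finset.smul_sum, smul_smul]
    exact Finset.sum_comm
  refine ⟨hD, fun g hg => ?_⟩
  obtain ⟨c, hc, hu⟩ := hθ.2 g hg
  refine ⟨Matrix.vecMul c M', ?_, ?_⟩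
  · simp only [key, Matrix.vecMul_vecMul, h2, Matrix.vecMul_one]
    exact hc
  · intro c' hc'
    simp only [key] at hc'
    have := hu _ hc'
    rw [← this, Matrix.vecMul_vecMul, h1, Matrix.vecMul_one]

/-- The linear-algebra data attached to a nonzero vector `a` of a plane `U`. -/
lemma exists_data (U : Submodule K (Fin ℓ → K)) (hU : Module.finrank K U ≤ 2)
    (P : (Fin ℓ → K) →ₗ[K] (Fin ℓ → K)) (hP : ∀ v, P v ∈ U) (hPU : ∀ v ∈ U, P v = v)
    (a : Fin ℓ → K) (ha : a ≠ 0) (haU : a ∈ U) :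
    ∃ (R : (Fin ℓ → K) →ₗ[K] (Fin ℓ → K)) (b : Fin ℓ → K), R a = 0 ∧ b ∈ U ∧ R b = b ∧
      (∀ v, lin a ∣ lin v - lin (R v)) ∧ ∀ v ∈ U, ∃ c : K, R v = c • b := by
  obtain ⟨φ, hφ⟩ := Module.Projective.exists_dual_ne_zero K ha
  let ψ : (Fin ℓ → K) →ₗ[K] K := (φ a)⁻¹ • φ
  have hψ : ψ a = 1 := by simp [ψ, hφ]
  let R : (Fin ℓ → K) →ₗ[K] (Fin ℓ → K) := LinearMap.id - ψ.smulRight a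
  have hR : ∀ v, R v = v - ψ v • a := fun v => by simp [R]
  have hRa : R a = 0 := by simp [hR, hψ]
  have hRR : ∀ v, R (R v) = R v := by
    intro v
    conv_lhs => rw [hR v]
    rw [map_sub, map_smul, hRa]; simp
  let W := LinearMap.range (R ∘ₗ U.subtype)
  have hW : Module.finrank K W ≤ 1 := by
    have h1 := LinearMap.finrank_range_add_finrank_ker (R ∘ₗ U.subtype)
    have h2 : 0 < Module.finrank K (LinearMap.ker (R ∘ₗ U.subtype)) := by
      refine (Module.finrank_pos_iff_exists_ne_zero (R := K) (M := LinearMap.ker (R ∘ₗ U.subtype))).mpr ?_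
      refine ⟨⟨⟨a, haU⟩, by simp [hRa]⟩, ?_⟩
      simpa [Subtype.ext_iff] using ha
    change Module.finrank K (LinearMap.range (R ∘ₗ U.subtype)) ≤ 1
    omega
  obtain ⟨⟨b, hb⟩, hbW⟩ := finrank_le_one_iff.mp hW
  obtain ⟨u, hu⟩ := hb
  have hub : R u = b := hu
  refine ⟨R, b, hRa, ?_, ?_, ?_, ?_⟩
  · rw [← hub, hR]
    exact U.sub_mem u.2 (U.smul_mem _ haU)
  · rw [← hub, hRR]
  · intro v
    rw [← lin_sub, hR, sub_sub_cancel, lin_smul]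
    exact dvd_mul_left _ _
  · intro v hv
    obtain ⟨c, hc⟩ := hbW ⟨R v, ⟨⟨v, hv⟩, rfl⟩⟩
    exact ⟨c, (congrArg Subtype.val hc).symm⟩

lemma step {I : Type} [Fintype I]
    (α : I → Fin ℓ → K) (ν ν' : I → ℕ)
    (U : Submodule K (Fin ℓ → K)) (hU : Module.finrank K U ≤ 2)
    (P : (Fin ℓ → K) →ₗ[K] (Fin ℓ → K)) (hP : ∀ v, P v ∈ U) (hPU : ∀ v ∈ U, P v = v)
    (hα : ∀ i, α i ∈ U) (i : I) (hi : ν' i = ν i + 1) (hne : ∀ j, j ≠ i → ν' j = ν j)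
    (ih : ∃ θ : Fin ℓ → Fin ℓ → MvPolynomial (Fin ℓ) K, isBasisOf (memD α ν) θ ∧
      ∀ j i, hat P (derAp (θ j) (α i)) = derAp (θ j) (α i)) :
    ∃ θ : Fin ℓ → Fin ℓ → MvPolynomial (Fin ℓ) K, isBasisOf (memD α ν') θ ∧
      ∀ j i, hat P (derAp (θ j) (α i)) = derAp (θ j) (α i) := by
  obtain ⟨θ, hθ, hinv⟩ := ih
  have hmem : ∀ f, memD α ν' f ↔ memD α ν f ∧ lin (α i) ^ (ν i + 1) ∣ derAp f (α i) := by
    intro f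
    constructor
    · intro h
      refine ⟨fun j => ?_, hi ▸ h i⟩
      by_cases hj : j = i
      · subst hj
        exact (pow_dvd_pow _ (by omega)).trans (h j)
      · exact hne j hj ▸ h j
    · rintro ⟨h1, h2⟩ j
      by_cases hj : j = i
      · subst hj; rw [hi]; exact h2
      · rw [hne j hj]; exact h1 j
  by_cases ha : α i = 0
  · have : memD α ν' = memD α ν := by
      funext f
      rw [hmem]
      have : derAp f (α i) = 0 := by simp [derAp, ha]
      simp [this]
    rw [this]
    exact ⟨θ, hθ, hinv⟩
  obtain ⟨R, b, hRa, hbU, hRb, hdvd, hspan⟩ := exists_data U hU P hP hPU _ ha (hα i)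
  set a := α i with ha_def
  have hlin := lin_ne_zero ha
  have hPlin : hat P (lin a) = lin a := by rw [hat_lin, hPU _ (hα i)]
  have hRlin : hat R (lin a) = 0 := by rw [hat_lin, hRa]; simp [lin_eq]
  have hker : ∀ p, lin a ∣ p ↔ hat R p = 0 := by
    intro p
    constructor
    · rintro ⟨q, rfl⟩
      rw [map_mul, hRlin, zero_mul]
    · intro h
      simpa [h] using dvd_sub_hat R (lin a) hdvd p
  -- the principal ideal domain
  let A : Subalgebra K (MvPolynomial (Fin ℓ) K) := (Polynomial.aeval (lin b)).range
  have hPID : IsPrincipalIdealRing A :=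
    IsPrincipalIdealRing.of_surjective (Polynomial.aeval (R := K) (lin b)).rangeRestrict
      (Polynomial.aeval (R := K) (lin b)).rangeRestrict_surjective
  have hAR : ∀ x ∈ A, hat R x = x := by
    rintro _ ⟨q, rfl⟩
    change hat R (Polynomial.aeval (lin b) q) = Polynomial.aeval (lin b) q
    rw [← Polynomial.aeval_algHom_apply, hat_lin, hRb]
  have hAP : ∀ x ∈ A, hat P x = x := by
    rintro _ ⟨q, rfl⟩
    change hat P (Polynomial.aeval (lin b) q) = Polynomial.aeval (lin b) q
    rw [← Polynomial.aeval_algHom_apply, hat_lin, hPU _ hbU]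
  have hRP : ∀ p, hat R (hat P p) ∈ A := by
    intro p
    induction p using MvPolynomial.induction_on with
    | C c =>
      have h1 : hat P (C c) = C c := (hat P).commutes c
      have h2 : hat R (C c) = C c := (hat R).commutes c
      rw [h1, h2]
      exact A.algebraMap_mem c
    | add p q hp hq => rw [map_add, map_add]; exact A.add_mem hp hq
    | mul_X p k hp =>
      rw [map_mul, map_mul]
      refine A.mul_mem hp ?_
      rw [← lin_single, hat_lin, hat_lin]
      obtain ⟨c, hc⟩ := hspan _ (hP (Pi.single k 1))
      rw [hc, lin_smul]
      exact A.mul_mem (A.algebraMap_mem c) ⟨Polynomial.X, by simp⟩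
  obtain ⟨k0⟩ : Nonempty (Fin ℓ) := by
    by_contra h
    apply ha
    funext k
    exact (h ⟨k⟩).elim
  choose g hg using fun j => hθ.1 j i
  have hgP : ∀ j, hat P (g j) = g j := by
    intro j
    have h := hinv j i
    rw [hg j, map_mul, map_pow, hPlin] at h
    exact mul_left_cancel₀ (pow_ne_zero _ hlin) h
  have hgA : ∀ j, hat R (g j) ∈ A := fun j => by
    have := hRP (g j)
    rwa [hgP] at this
  let w : Fin ℓ → A := fun j => ⟨hat R (g j), hgA j⟩
  obtain ⟨B, i0, hB⟩ := pid_basis k0 (Fintype.linearCombination A w)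
  let M : Matrix (Fin ℓ) (Fin ℓ) (MvPolynomial (Fin ℓ) K) := fun j k => (B j k : A)
  let M' : Matrix (Fin ℓ) (Fin ℓ) (MvPolynomial (Fin ℓ) K) :=
    fun j k => (B.repr (Pi.single j 1) k : A)
  have hMM' : M' * M = 1 := by
    ext1 j k
    have h := congrFun (B.sum_repr (Pi.single j 1)) k
    have h' := congrArg (Subtype.val) h
    simp only [Finset.sum_apply, Pi.smul_apply, smul_eq_mul, AddSubmonoidClass.coe_finsetSum,
      MulMemClass.coe_mul] at h'
    rw [Matrix.mul_apply]
    refine h'.trans ?_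
    rw [Matrix.one_apply, Pi.single_apply]
    by_cases hjk : j = k
    · simp [hjk]
    · simp [hjk, Ne.symm hjk]
  have hM : M * M' = 1 := mul_eq_one_comm.mp hMM'
  let θ' : Fin ℓ → Fin ℓ → MvPolynomial (Fin ℓ) K := fun j => ∑ k, M j k • θ k
  have hθ'D : ∀ j, memD α ν (θ' j) := by
    intro j m
    simp only [θ', derAp_comb]
    exact Finset.dvd_sum fun k _ => (hθ.1 k m).mul_left _
  have hθ' : isBasisOf (memD α ν) θ' := basis_change hθ M M' hM hθ'D
  have hinv' : ∀ j m, hat P (derAp (θ' j) (α m)) = derAp (θ' j) (α m) := by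
    intro j m
    simp only [θ', derAp_comb, map_sum, map_mul, hinv]
    exact Finset.sum_congr rfl fun k _ => by rw [hAP _ (B j k).2]
  let g' : Fin ℓ → MvPolynomial (Fin ℓ) K := fun j => ∑ k, M j k * g k
  have hg' : ∀ j, derAp (θ' j) a = lin a ^ ν i * g' j := by
    intro j
    simp only [θ', g', derAp_comb, Finset.mul_sum]
    exact Finset.sum_congr rfl fun k _ => by rw [hg k]; ring
  have hg'0 : ∀ j, j ≠ i0 → lin a ∣ g' j := by
    intro j hj
    rw [hker]
    have h := congrArg Subtype.val (hB j hj)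
    simp only [Fintype.linearCombination_apply, smul_eq_mul, AddSubmonoidClass.coe_finsetSum,
      MulMemClass.coe_mul, ZeroMemClass.coe_zero] at h
    rw [← h]
    simp only [g', map_sum, map_mul]
    exact Finset.sum_congr rfl fun k _ => by rw [hAR _ (B j k).2]
  have hpow : ∀ p, lin a ^ (ν i + 1) ∣ lin a ^ ν i * p ↔ lin a ∣ p := by
    intro p
    rw [pow_succ]
    exact mul_dvd_mul_iff_left (pow_ne_zero _ hlin)
  by_cases hcase : lin a ∣ g' i0
  · have hall : ∀ j, lin a ∣ g' j := fun j => by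
      by_cases hj : j = i0
      · rw [hj]; exact hcase
      · exact hg'0 j hj
    refine ⟨θ', ⟨fun j => (hmem _).2 ⟨hθ'D j, ?_⟩, fun f hf => hθ'.2 f ((hmem f).1 hf).1⟩, hinv'⟩
    rw [hg', hpow]; exact hall j
  · let s : Fin ℓ → MvPolynomial (Fin ℓ) K := fun j => if j = i0 then lin a else 1
    have hs : ∀ j, s j ≠ 0 := fun j => by
      by_cases hj : j = i0 <;> simp [s, hj, hlin]
    have hs' : ∀ j, lin a ∣ s j * g' j := fun j => by
      by_cases hj : j = i0
      · simp [s, hj]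
      · simpa [s, hj] using hg'0 j hj
    refine ⟨fun j => s j • θ' j, ⟨fun j => (hmem _).2 ⟨fun m => ?_, ?_⟩, fun f hf => ?_⟩, ?_⟩
    · rw [derAp_smul]; exact (hθ'D j m).mul_left _
    · rw [derAp_smul, hg', mul_left_comm, hpow]; exact hs' j
    · obtain ⟨hf1, hf2⟩ := (hmem f).1 hf
      obtain ⟨c, hc, hcu⟩ := hθ'.2 f hf1
      have h1 : lin a ∣ ∑ j, c j * g' j := by
        rw [← hpow, Finset.mul_sum]
        have : derAp f a = ∑ j, lin a ^ ν i * (c j * g' j) := by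
          rw [hc, derAp_comb]
          exact Finset.sum_congr rfl fun k _ => by rw [hg']; ring
        rwa [← this]
      have h2 : lin a ∣ c i0 * g' i0 := by
        rw [← Finset.add_sum_erase _ _ (Finset.mem_univ i0)] at h1
        refine (dvd_add_left (Finset.dvd_sum fun j hj => ?_)).1 h1
        exact (hg'0 j (Finset.ne_of_mem_erase hj)).mul_left _
      have h3 : lin a ∣ c i0 := by
        rw [hker, map_mul] at h2
        rw [hker] at hcase ⊢
        exact (mul_eq_zero.1 h2).resolve_right hcase
      have h4 : ∀ j, s j ∣ c j := fun j => by
        by_cases hj : j = i0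
        · simpa [s, hj] using h3
        · simp [s, hj]
      choose d hd using h4
      refine ⟨d, ?_, ?_⟩
      · simp only [smul_smul]
        rw [hc]
        exact Finset.sum_congr rfl fun j _ => by rw [hd j, mul_comm]
      · intro d' hd'
        simp only [smul_smul] at hd'
        have := hcu _ hd'
        funext j
        have hj := congrFun this j
        rw [hd j, mul_comm] at hj
        exact mul_left_cancel₀ (hs j) hj
    · intro j m
      simp only [derAp_smul, map_mul, hinv']
      congr 1
      by_cases hj : j = i0
      · simp [s, hj, hPlin]
      · simp [s, hj]

end helpers

/-- Every multiarrangement of rank at most 2 is free: if the span of the defining forms has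
dimension at most 2, then `D(A,ν)` is a free `S`-module of rank `ℓ`, the dimension of the
ambient space. -/
theorem stmt3 {K : Type} [Field K] {ℓ : ℕ} {I : Type} [Fintype I]
    (α : I → Fin ℓ → K) (ν : I → ℕ)
    (hrank : Module.finrank K (Submodule.span K (Set.range α)) ≤ 2) :
    ∃ θ : Fin ℓ → Fin ℓ → MvPolynomial (Fin ℓ) K, isBasisOf (memD α ν) θ := by
  classical
  set U := Submodule.span K (Set.range α) with hUdef
  have hα : ∀ i, α i ∈ U := fun i => Submodule.subset_span ⟨i, rfl⟩
  obtain ⟨p, hp⟩ := LinearMap.exists_leftInverse_of_injective U.subtype U.ker_subtype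
  let P : (Fin ℓ → K) →ₗ[K] (Fin ℓ → K) := U.subtype ∘ₗ p
  have hP : ∀ v, P v ∈ U := fun v => (p v).2
  have hPU : ∀ v ∈ U, P v = v := fun v hv =>
    congrArg Subtype.val (LinearMap.congr_fun hp (⟨v, hv⟩ : U))
  suffices H : ∀ (n : ℕ) (ν : I → ℕ), ∑ i, ν i = n →
      ∃ θ : Fin ℓ → Fin ℓ → MvPolynomial (Fin ℓ) K, isBasisOf (memD α ν) θ ∧
        ∀ j i, hat P (derAp (θ j) (α i)) = derAp (θ j) (α i) by
    obtain ⟨θ, h, -⟩ := H _ ν rfl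
    exact ⟨θ, h⟩
  intro n
  induction n with
  | zero =>
    intro ν hν
    have hν0 : ∀ i, ν i = 0 := by simpa using hν
    refine ⟨fun j => Pi.single j 1, ⟨fun j i => by simp [hν0], fun g _ => ?_⟩, ?_⟩
    · have key : ∀ c : Fin ℓ → MvPolynomial (Fin ℓ) K,
          ∑ j, c j • (Pi.single j 1 : Fin ℓ → MvPolynomial (Fin ℓ) K) = c := fun c => by
        funext k
        simp [Finset.sum_apply, Pi.single_apply]
      refine ⟨g, (key g).symm, fun c hc => ?_⟩
      simp only [key] at hc
      exact hc.symm
    · intro j i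
      have : derAp (Pi.single j 1) (α i) = C (α i j) := by
        simp [derAp, Pi.single_apply]
      rw [this]
      exact (hat P).commutes _
  | succ n ih =>
    intro ν hν
    have : ∃ i, ν i ≠ 0 := by
      by_contra! h
      simp [h] at hν
    obtain ⟨i, hi⟩ := this
    refine step α (Function.update ν i (ν i - 1)) ν U hrank P hP hPU hα i ?_ ?_ (ih _ ?_)
    · simp; omega
    · intro j hj; simp [hj]
    · rw [← Finset.add_sum_erase _ _ (Finset.mem_univ i)] at hν ⊢
      have : ∑ j ∈ Finset.univ.erase i, Function.update ν i (ν i - 1) j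
          = ∑ j ∈ Finset.univ.erase i, ν j :=
        Finset.sum_congr rfl fun j hj => by simp [Finset.ne_of_mem_erase hj]
      rw [this]
      simp; omega
end

section
/- Terao's theorem for braid arrangements (type A): for the Coxeter arrangement A_{ℓ-1} of type A_{ℓ-1} in the hyperplane {Σ x_i = 0} ⊂ K^ℓ with constant multiplicity m ≥ 1, the multiarrangement (A_{ℓ-1}, m) is free with exponents {mℓ/2, ..., mℓ/2} (ℓ-1 copies) when m is even, and {(m-1)ℓ/2 + 1, (m-1)ℓ/2 + 2, ..., (m-1)ℓ/2 + ℓ - 1} when m is odd. -/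
set_option linter.unusedSectionVars false

section frozen
open MvPolynomial

/-- `D(B_ℓ, m)` for the braid arrangement with hyperplanes `ker(x_i - x_j)`, `i < j`, and
constant multiplicity `m`: the derivation `∑ fᵢ ∂/∂xᵢ` sends `x_i - x_j` to `f i - f j`. -/
def braidD (K : Type) [Field K] (ℓ m : ℕ) (f : Fin ℓ → MvPolynomial (Fin ℓ) K) : Prop :=
  ∀ i j : Fin ℓ, i < j → (X i - X j : MvPolynomial (Fin ℓ) K) ^ m ∣ f i - f j

end frozen

section gen
open Polynomial
variable {K S : Type} [Field K] [CharZero K] [CommRing S] [IsDomain S] [Algebra K S]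

/-- Formal antiderivative with zero constant term. -/
noncomputable def antid (K : Type) {S : Type} [Field K] [CommRing S] [Algebra K S] :
    S[X] →ₗ[S] S[X] :=
  Polynomial.lsum (fun k => (algebraMap K S ((k : K) + 1)⁻¹) • Polynomial.monomial (k + 1))

theorem antid_monomial (k : ℕ) (a : S) :
    antid K (monomial k a) = monomial (k + 1) (algebraMap K S ((k : K) + 1)⁻¹ * a) := by
  rw [antid, Polynomial.lsum_apply, Polynomial.sum_monomial_index _ _ (by simp)]
  rw [LinearMap.smul_apply, Polynomial.smul_monomial, smul_eq_mul]

theorem antid_coeff_zero (p : S[X]) : (antid K p).coeff 0 = 0 := by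
  induction p using Polynomial.induction_on' with
  | add p q hp hq => simp [hp, hq]
  | monomial n a => rw [antid_monomial, coeff_monomial]; simp

theorem antid_coeff_succ (p : S[X]) (k : ℕ) :
    (antid K p).coeff (k + 1) = algebraMap K S ((k : K) + 1)⁻¹ * p.coeff k := by
  induction p using Polynomial.induction_on' with
  | add p q hp hq => simp [hp, hq, mul_add]
  | monomial n a =>
    rw [antid_monomial, coeff_monomial, coeff_monomial]
    by_cases h : n = k <;> simp [h]

theorem antid_inv (k : ℕ) : algebraMap K S ((k : K) + 1)⁻¹ * ((k : S) + 1) = 1 := by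
  have h : ((k : S) + 1) = algebraMap K S ((k : K) + 1) := by simp
  rw [h, ← map_mul, inv_mul_cancel₀ (Nat.cast_add_one_ne_zero k), map_one]

theorem derivative_antid (p : S[X]) : derivative (antid K p) = p := by
  ext k
  rw [coeff_derivative, antid_coeff_succ]
  have := antid_inv (K := K) (S := S) k
  linear_combination p.coeff k * this

theorem antid_derivative (p : S[X]) : antid K (derivative p) = p - C (p.coeff 0) := by
  ext k
  cases k with
  | zero => simp [antid_coeff_zero]
  | succ k =>
    rw [antid_coeff_succ, coeff_derivative]
    have := antid_inv (K := K) (S := S) k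
    simp only [coeff_sub, coeff_C_succ, sub_zero]
    linear_combination p.coeff (k+1) * this

theorem antid_dvd (p : S[X]) (u v : S) (a b : ℕ) (h : (X - C u) ^ a * (X - C v) ^ b ∣ p) :
    (u - v) ^ (a + b + 1) ∣ eval u (antid K p) - eval v (antid K p) := by
  obtain ⟨q, hq⟩ := h
  set H : S[X] := (antid K p).comp (C v + C (u - v) * X) with hH
  have hd : derivative H = C ((u - v) ^ (a + b + 1)) *
      ((X - 1) ^ a * X ^ b * q.comp (C v + C (u - v) * X)) := by
    rw [hH, derivative_comp, derivative_antid, hq]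
    have e1 : (X - C u : S[X]).comp (C v + C (u - v) * X) = C (u - v) * (X - 1) := by
      simp; ring
    have e2 : (X - C v : S[X]).comp (C v + C (u - v) * X) = C (u - v) * X := by
      simp
    rw [mul_comp, mul_comp, pow_comp, pow_comp, e1, e2]
    have e3 : derivative (C v + C (u - v) * X : S[X]) = C (u - v) := by
      simp
    rw [e3, C_pow, mul_pow, mul_pow]
    ring
  have h2 := antid_derivative (K := K) H
  rw [hd, ← smul_eq_C_mul, map_smul] at h2
  have h3 := congrArg (eval 1) h2
  have h4 : eval 1 H = eval u (antid K p) := by simp [hH, eval_comp]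
  have h5 : H.coeff 0 = eval v (antid K p) := by
    rw [coeff_zero_eq_eval_zero]; simp [hH, eval_comp]
  rw [eval_smul, eval_sub, eval_C, h4, h5, smul_eq_mul] at h3
  exact ⟨_, h3.symm⟩

theorem pow_dvd_of_der [CharZero S] (F : S[X]) (u : S) (a : ℕ) (h0 : eval u F = 0)
    (hF : F ≠ 0) (hF' : derivative F ≠ 0)
    (h : (X - C u) ^ a ∣ derivative F) : a + 1 ≤ rootMultiplicity u F := by
  have h1 := (le_rootMultiplicity_iff hF').2 h
  rw [derivative_rootMultiplicity_of_root h0] at h1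
  have : 0 < rootMultiplicity u F := (rootMultiplicity_pos hF).2 h0
  omega

theorem eq_zero_of_der [CharZero S] {ι : Type} [Fintype ι] [Nonempty ι] (x : ι → S)
    (hx : Function.Injective x)
    (F : S[X]) (E : ι → ℕ) (h0 : ∀ i, eval (x i) F = 0)
    (h : ∀ i, (X - C (x i)) ^ (E i) ∣ derivative F)
    (hdeg : F.natDegree < ∑ i, (E i + 1)) : F = 0 := by
  classical
  by_contra hF
  by_cases hF' : derivative F = 0
  · rw [eq_C_of_derivative_eq_zero hF'] at h0 hF
    obtain ⟨i⟩ := ‹Nonempty ι›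
    have := h0 i
    simp at this
    simp [this] at hF
  have h1 : ∑ i, (E i + 1) ≤ ∑ i, F.roots.count (x i) := by
    refine Finset.sum_le_sum fun i _ => ?_
    rw [count_roots]
    exact pow_dvd_of_der F _ _ (h0 i) hF hF' (h i)
  have h2 : ∑ i, F.roots.count (x i) = ∑ y ∈ Finset.univ.image x, F.roots.count y := by
    rw [Finset.sum_image (fun _ _ _ _ h => hx h)]
  have h3 : ∑ y ∈ Finset.univ.image x, F.roots.count y ≤ F.roots.card := by
    rw [← Multiset.toFinset_sum_count_eq]
    refine Finset.sum_le_sum_of_ne_zero ?_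
    intro y _ hy
    rw [Multiset.mem_toFinset]
    exact Multiset.count_ne_zero.1 hy
  have h4 := card_roots' F
  omega
end gen

open MvPolynomial

section saito
variable {K : Type} [Field K] [CharZero K] {ℓ : ℕ}

theorem X_sub_X_hom (i j : Fin ℓ) : (X i - X j : MvPolynomial (Fin ℓ) K).IsHomogeneous 1 :=
  (isHomogeneous_X _ _).sub (isHomogeneous_X _ _)

theorem X_sub_X_ne {i j : Fin ℓ} (h : i ≠ j) : (X i - X j : MvPolynomial (Fin ℓ) K) ≠ 0 := by
  rw [sub_ne_zero]
  exact fun h' => h (X_injective h')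

theorem X_sub_X_irred {i j : Fin ℓ} (h : i ≠ j) :
    Irreducible (X i - X j : MvPolynomial (Fin ℓ) K) := by
  apply irreducible_of_totalDegree_eq_one ((X_sub_X_hom i j).totalDegree (X_sub_X_ne h))
  intro x hx
  have h1 := hx (Finsupp.single i 1)
  have : coeff (Finsupp.single i 1) (X i - X j : MvPolynomial (Fin ℓ) K) = 1 := by
    rw [coeff_sub, coeff_X, coeff_X, if_pos rfl, if_neg]
    · simp
    · intro h'
      exact h (Finsupp.single_left_injective one_ne_zero h').symm
  rw [this] at h1
  exact isUnit_of_dvd_one h1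

theorem X_sub_X_not_dvd {i j k l : Fin ℓ} (h : i < j) (h' : k < l) (hne : (i, j) ≠ (k, l)) :
    ¬ (X i - X j : MvPolynomial (Fin ℓ) K) ∣ X k - X l := by
  intro hd
  let φ : Fin ℓ → K := fun a => if a = i then ((j : ℕ) : K) else ((a : ℕ) : K)
  have := map_dvd (MvPolynomial.eval φ) hd
  simp only [map_sub, eval_X] at this
  have h0 : φ i - φ j = 0 := by simp [φ]
  rw [h0, zero_dvd_iff, sub_eq_zero] at this
  simp only [φ] at this
  have hne' : ¬ (i = k ∧ j = l) := fun hh => hne (by rw [hh.1, hh.2])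
  split_ifs at this with h1 h2 h2
  all_goals (try subst h1); (try subst h2)
  · exact lt_irrefl _ h'
  · have := Fin.ext (Nat.cast_injective this)
    exact hne' ⟨rfl, this⟩
  · have := Fin.ext (Nat.cast_injective this)
    subst this
    exact lt_asymm h h'
  · have := Fin.ext (Nat.cast_injective this)
    exact h'.ne this

/-- index pairs -/
def pairs (ℓ : ℕ) : Finset (Fin ℓ × Fin ℓ) := Finset.univ.filter (fun p => p.1 < p.2)

theorem pairs_card : (pairs ℓ).card = ∑ i : Fin ℓ, (i : ℕ) := by
  rw [pairs, Finset.card_filter, ← Finset.univ_product_univ, Finset.sum_product_right]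
  refine Finset.sum_congr rfl fun i _ => ?_
  rw [← Finset.card_filter]
  have : Finset.univ.filter (fun x => x < i) = Finset.Iio i := by ext; simp
  rw [this, Fin.card_Iio]

/-- defining polynomial of the multiarrangement -/
noncomputable def Qm (K : Type) [Field K] (ℓ m : ℕ) : MvPolynomial (Fin ℓ) K :=
  ∏ p ∈ pairs ℓ, (X p.1 - X p.2) ^ m

theorem Qm_ne (m : ℕ) : Qm K ℓ m ≠ 0 := by
  rw [Qm, Finset.prod_ne_zero_iff]
  intro p hp
  simp only [pairs, Finset.mem_filter] at hp
  exact pow_ne_zero _ (X_sub_X_ne hp.2.ne)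

theorem Qm_hom (m : ℕ) : (Qm K ℓ m).IsHomogeneous (m * ∑ i : Fin ℓ, (i : ℕ)) := by
  have := IsHomogeneous.prod (pairs ℓ) (fun p => (X p.1 - X p.2 : MvPolynomial (Fin ℓ) K) ^ m)
    (fun _ => 1 * m) (fun p _ => (X_sub_X_hom p.1 p.2).pow m)
  rw [Finset.sum_const, pairs_card, smul_eq_mul, one_mul, mul_comm] at this
  exact this

theorem Qm_dvd (m : ℕ) (z : MvPolynomial (Fin ℓ) K)
    (h : ∀ i j : Fin ℓ, i < j → (X i - X j : MvPolynomial (Fin ℓ) K) ^ m ∣ z) : Qm K ℓ m ∣ z := by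
  refine Finset.prod_dvd_of_isRelPrime ?_ ?_
  · intro p hp q hq hpq
    simp only [pairs, Finset.coe_filter, Set.mem_ofPred_eq] at hp hq
    refine IsRelPrime.pow ?_
    rw [(X_sub_X_irred hp.2.ne).isRelPrime_iff_not_dvd]
    exact X_sub_X_not_dvd hp.2 hq.2 hpq
  · intro p hp
    simp only [pairs, Finset.mem_filter] at hp
    exact h _ _ hp.2

theorem Qm_dvd_det (m : ℕ) (M : Matrix (Fin ℓ) (Fin ℓ) (MvPolynomial (Fin ℓ) K))
    (h : ∀ a, braidD K ℓ m (M a)) : Qm K ℓ m ∣ M.det := by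
  refine Qm_dvd m _ fun i j hij => ?_
  choose c hc using fun a => h a i j hij
  have h1 : M.det = (M.updateCol i (fun k => M k i + (-1 : MvPolynomial (Fin ℓ) K) • M k j)).det :=
    (Matrix.det_updateCol_add_smul_self M hij.ne (-1)).symm
  have h2 : (fun k => M k i + (-1 : MvPolynomial (Fin ℓ) K) • M k j) =
      ((X i - X j : MvPolynomial (Fin ℓ) K) ^ m) • c := by
    funext k
    simp only [Pi.smul_apply, smul_eq_mul, ← hc k]
    ring
  rw [h1, h2, Matrix.det_updateCol_smul]
  exact dvd_mul_right _ _

theorem saito (m : ℕ) (θ : Fin ℓ → Fin ℓ → MvPolynomial (Fin ℓ) K) (d : Fin ℓ → ℕ)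
    (hD : ∀ a, braidD K ℓ m (θ a)) (hh : ∀ a i, (θ a i).IsHomogeneous (d a))
    (hsum : ∑ a, d a = m * ∑ i : Fin ℓ, (i : ℕ))
    (hind : ∀ v : Fin ℓ → MvPolynomial (Fin ℓ) K, (∀ i, ∑ a, v a * θ a i = 0) → v = 0) :
    isBasisOf (braidD K ℓ m) θ := by
  let M : Matrix (Fin ℓ) (Fin ℓ) (MvPolynomial (Fin ℓ) K) := Matrix.of θ
  have hdet : M.det ≠ 0 := by
    intro h0
    obtain ⟨v, hv, hv'⟩ := Matrix.exists_vecMul_eq_zero_iff.2 h0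
    exact hv (hind v fun i => congrFun hv' i)
  have hdh : M.det.IsHomogeneous (∑ a, d a) := by
    rw [← Matrix.det_transpose, Matrix.det_apply]
    refine IsHomogeneous.sum _ _ _ fun σ _ => ?_
    have h1 := IsHomogeneous.prod Finset.univ (fun i => Matrix.transpose M (σ i) i) d
      (fun i _ => hh i (σ i))
    rcases Int.units_eq_one_or (Equiv.Perm.sign σ) with hs | hs <;> rw [hs]
    · simpa using h1
    · simpa using h1.neg
  obtain ⟨u, hu⟩ := Qm_dvd_det m M hD
  have hu0 : u ≠ 0 := by
    rintro rfl
    exact hdet (by rw [hu, mul_zero])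
  have hdeg := totalDegree_mul_of_isDomain (Qm_ne (K := K) (ℓ := ℓ) m) hu0
  rw [← hu, hdh.totalDegree hdet, (Qm_hom m).totalDegree (Qm_ne m), hsum] at hdeg
  have hu1 : u = C (coeff 0 u) := totalDegree_eq_zero_iff_eq_C.1 (by omega)
  have hc : coeff 0 u ≠ 0 := by
    intro h; rw [h, C_0] at hu1; exact hu0 hu1
  have hdd : M.det ∣ Qm K ℓ m := by
    refine ⟨C (coeff 0 u)⁻¹, ?_⟩
    rw [hu, mul_assoc]
    nth_rewrite 1 [hu1]
    rw [← C_mul, mul_inv_cancel₀ hc, C_1, mul_one]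
  refine ⟨hD, fun g hg => ?_⟩
  have hcr : ∀ a, M.det ∣ (M.updateRow a g).det := by
    intro a
    refine hdd.trans (Qm_dvd_det m _ fun b => ?_)
    by_cases hb : b = a
    · subst hb
      rw [Matrix.updateRow_self]; exact hg
    · rw [Matrix.updateRow_ne hb]; exact hD b
  choose c hcc using hcr
  have key : g = ∑ a, c a • θ a := by
    have h1 := Matrix.mulVec_cramer M.transpose g
    funext i
    have h2 := congrFun h1 i
    simp only [Matrix.mulVec, dotProduct, Matrix.cramer_transpose_apply, Matrix.det_transpose,
      Matrix.transpose_apply, hcc, Pi.smul_apply, smul_eq_mul] at h2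
    apply mul_left_cancel₀ hdet
    rw [← h2, Finset.sum_apply, Finset.mul_sum]
    refine Finset.sum_congr rfl fun a _ => ?_
    simp only [Pi.smul_apply, smul_eq_mul, M, Matrix.of_apply]
    ring
  refine ⟨c, key, fun c' hc' => ?_⟩
  have : c' - c = 0 := by
    apply hind
    intro i
    have h1 := congrFun (key.symm.trans hc') i
    simp only [Finset.sum_apply, Pi.smul_apply, smul_eq_mul] at h1
    simp only [Pi.sub_apply, sub_mul, Finset.sum_sub_distrib, h1, sub_self]
  exact sub_eq_zero.1 this
end saito

section hom
variable {K : Type} [Field K] [CharZero K] {ℓ : ℕ}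

/-- total homogeneity of degree `d` of a univariate polynomial over the polynomial ring -/
def HD (p : Polynomial (MvPolynomial (Fin ℓ) K)) (d : ℕ) : Prop :=
  p.natDegree ≤ d ∧ ∀ k e, e + k = d → (p.coeff k).IsHomogeneous e

theorem HD.mul {p q : Polynomial (MvPolynomial (Fin ℓ) K)} {d e : ℕ} (hp : HD p d) (hq : HD q e) :
    HD (p * q) (d + e) := by
  refine ⟨Polynomial.natDegree_mul_le.trans (add_le_add hp.1 hq.1), fun k f hf => ?_⟩
  rw [Polynomial.coeff_mul]
  refine IsHomogeneous.sum _ _ _ fun x hx => ?_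
  rw [Finset.HasAntidiagonal.mem_antidiagonal] at hx
  by_cases h1 : d < x.1
  · rw [Polynomial.coeff_eq_zero_of_natDegree_lt (hp.1.trans_lt h1), zero_mul]
    exact isHomogeneous_zero _ _ _
  by_cases h2 : e < x.2
  · rw [Polynomial.coeff_eq_zero_of_natDegree_lt (hq.1.trans_lt h2), mul_zero]
    exact isHomogeneous_zero _ _ _
  have h3 : f = (d - x.1) + (e - x.2) := by omega
  rw [h3]
  exact (hp.2 _ _ (by omega)).mul (hq.2 _ _ (by omega))

theorem HD.one : HD (1 : Polynomial (MvPolynomial (Fin ℓ) K)) 0 := by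
  refine ⟨by simp, fun k e h => ?_⟩
  obtain ⟨rfl, rfl⟩ : e = 0 ∧ k = 0 := by omega
  simpa using isHomogeneous_one _ _

theorem HD.pow {p : Polynomial (MvPolynomial (Fin ℓ) K)} {d : ℕ} (hp : HD p d) (n : ℕ) :
    HD (p ^ n) (n * d) := by
  induction n with
  | zero => simpa using HD.one
  | succ n ih => rw [pow_succ, Nat.succ_mul]; exact ih.mul hp

theorem HD.prod {ι : Type} (s : Finset ι) (p : ι → Polynomial (MvPolynomial (Fin ℓ) K)) (d : ℕ)
    (hp : ∀ i ∈ s, HD (p i) d) : HD (∏ i ∈ s, p i) (s.card * d) := by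
  classical
  induction s using Finset.induction_on with
  | empty => simpa using HD.one
  | insert a s ha ih =>
    rw [Finset.prod_insert ha, Finset.card_insert_of_notMem ha, Nat.succ_mul, add_comm]
    exact (hp a (by simp)).mul (ih fun i hi => hp i (by simp [hi]))

theorem HD.X : HD (Polynomial.X : Polynomial (MvPolynomial (Fin ℓ) K)) 1 := by
  refine ⟨Polynomial.natDegree_X_le, fun k e h => ?_⟩
  rw [Polynomial.coeff_X]
  split_ifs with h1
  · obtain rfl : e = 0 := by omega
    exact isHomogeneous_one _ _
  · exact isHomogeneous_zero _ _ _

theorem HD.X_sub (i : Fin ℓ) :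
    HD (Polynomial.X - Polynomial.C (MvPolynomial.X i) : Polynomial (MvPolynomial (Fin ℓ) K)) 1 := by
  refine ⟨Polynomial.natDegree_X_sub_C_le _, fun k e h => ?_⟩
  rw [Polynomial.coeff_sub]
  refine (HD.X.2 k e h).sub ?_
  rw [Polynomial.coeff_C]
  split_ifs with h1
  · obtain rfl : e = 1 := by omega
    exact isHomogeneous_X _ _
  · exact isHomogeneous_zero _ _ _

theorem HD.antid {p : Polynomial (MvPolynomial (Fin ℓ) K)} {d : ℕ} (hp : HD p d) :
    HD (antid K p) (d + 1) := by
  constructor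
  · rw [Polynomial.natDegree_le_iff_coeff_eq_zero]
    intro N hN
    obtain ⟨N, rfl⟩ : ∃ M, N = M + 1 := ⟨N - 1, by omega⟩
    rw [antid_coeff_succ, Polynomial.coeff_eq_zero_of_natDegree_lt (hp.1.trans_lt (by omega)),
      mul_zero]
  · intro k e h
    cases k with
    | zero => rw [antid_coeff_zero]; exact isHomogeneous_zero _ _ _
    | succ k =>
      rw [antid_coeff_succ]
      exact (hp.2 k e (by omega)).C_mul _

theorem HD.eval {p : Polynomial (MvPolynomial (Fin ℓ) K)} {d : ℕ} (hp : HD p d) (i : Fin ℓ) :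
    (Polynomial.eval (MvPolynomial.X i) p).IsHomogeneous d := by
  rw [Polynomial.eval_eq_sum_range]
  refine IsHomogeneous.sum _ _ _ fun k hk => ?_
  have hk' : k ≤ d := by
    have := hp.1
    rw [Finset.mem_range] at hk
    omega
  have := (hp.2 k (d - k) (by omega)).mul (isHomogeneous_X_pow (R := K) i k)
  rwa [Nat.sub_add_cancel hk'] at this

/-- the derivations attached to a family of integrands -/
noncomputable def thetaOf [NeZero ℓ] (p : Fin ℓ → Polynomial (MvPolynomial (Fin ℓ) K)) :
    Fin ℓ → Fin ℓ → MvPolynomial (Fin ℓ) K :=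
  fun a i => if a = 0 then 1 else Polynomial.eval (MvPolynomial.X i) (antid K (p a))

theorem construct [NeZero ℓ] (m : ℕ) (d E : Fin ℓ → ℕ)
    (p : Fin ℓ → Polynomial (MvPolynomial (Fin ℓ) K))
    (hdiv : ∀ a, a ≠ 0 → ∀ i j : Fin ℓ, i < j → ∃ e f, e + f + 1 = m ∧
      (Polynomial.X - Polynomial.C (X i)) ^ e * (Polynomial.X - Polynomial.C (X j)) ^ f ∣ p a)
    (hhom : ∀ a, a ≠ 0 → HD (p a) (d a))
    (hsum : ∑ a : Fin ℓ, (if a = 0 then 0 else d a + 1) = m * ∑ i : Fin ℓ, (i : ℕ))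
    (hE : ∀ a, a ≠ 0 → ∀ i, (Polynomial.X - Polynomial.C (X i)) ^ (E i) ∣ p a)
    (hdE : ∀ a, a ≠ 0 → d a + 1 < ∑ i, (E i + 1))
    (hlin : ∀ v : Fin ℓ → MvPolynomial (Fin ℓ) K,
      ∑ a ∈ Finset.univ.erase 0, v a • p a = 0 → ∀ a, a ≠ 0 → v a = 0) :
    isBasisOf (braidD K ℓ m) (thetaOf p) ∧
      ∀ a, homogOf (thetaOf p a) (if a = 0 then 0 else d a + 1) := by
  have hh : ∀ a i, (thetaOf p a i).IsHomogeneous (if a = 0 then 0 else d a + 1) := by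
    intro a i
    unfold thetaOf
    split_ifs with h
    · exact isHomogeneous_one _ _
    · exact ((hhom a h).antid).eval i
  refine ⟨?_, fun a i => Or.inr (hh a i)⟩
  refine saito m _ _ ?_ hh hsum ?_
  · intro a i j hij
    unfold thetaOf
    split_ifs with h
    · simp
    · obtain ⟨e, f, rfl, hd⟩ := hdiv a h i j hij
      exact antid_dvd _ _ _ _ _ hd
  · intro v hv
    set P := ∑ a ∈ Finset.univ.erase 0, v a • p a with hP
    set F : Polynomial (MvPolynomial (Fin ℓ) K) := Polynomial.C (v 0) + antid K P with hF
    have hF' : Polynomial.derivative F = P := by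
      rw [hF, Polynomial.derivative_add, Polynomial.derivative_C, zero_add, derivative_antid]
    have hF0 : F = 0 := by
      refine eq_zero_of_der (fun i : Fin ℓ => (X i : MvPolynomial (Fin ℓ) K)) X_injective F E
        ?_ ?_ ?_
      · intro i
        have h1 := hv i
        rw [← Finset.add_sum_erase _ _ (Finset.mem_univ 0)] at h1
        rw [hF, hP, map_sum, Polynomial.eval_add, Polynomial.eval_finsetSum, Polynomial.eval_C,
          ← h1]
        congr 1
        · simp [thetaOf]
        · refine Finset.sum_congr rfl fun a ha => ?_
          rw [map_smul, Polynomial.eval_smul, thetaOf, if_neg (Finset.ne_of_mem_erase ha),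
            smul_eq_mul]
      · intro i
        rw [hF', hP]
        refine Finset.dvd_sum fun a ha => ?_
        rw [Polynomial.smul_eq_C_mul]
        exact (hE a (Finset.ne_of_mem_erase ha) i).mul_left _
      · have h0 : 0 < ∑ i : Fin ℓ, (E i + 1) :=
          Finset.sum_pos (fun i _ => Nat.succ_pos _) ⟨0, Finset.mem_univ _⟩
        have : F.natDegree ≤ ∑ i, (E i + 1) - 1 := by
          rw [hF, hP, map_sum]
          refine Polynomial.natDegree_add_le_of_degree_le (by simp) ?_
          refine Polynomial.natDegree_sum_le_of_forall_le _ _ fun a ha => ?_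
          have ha' := Finset.ne_of_mem_erase ha
          rw [map_smul]
          refine (Polynomial.natDegree_smul_le _ _).trans ?_
          have h1 := ((hhom a ha').antid).1
          have h2 := hdE a ha'
          omega
        omega
    have hP0 : P = 0 := by rw [← hF', hF0, Polynomial.derivative_zero]
    have hv0 : v 0 = 0 := by
      rw [hF, hP0, map_zero, add_zero] at hF0
      exact Polynomial.C_eq_zero.1 hF0
    funext a
    by_cases ha : a = 0
    · rw [ha, hv0]; rfl
    · exact hlin v hP0 a ha

theorem two_dvd_prod {R : Type} [CommRing R] (f : Fin ℓ → R) (s : Finset (Fin ℓ)) {i j : Fin ℓ}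
    (hij : i ≠ j) (hi : i ∈ s) (hj : j ∈ s) : f i * f j ∣ ∏ k ∈ s, f k := by
  rw [← Finset.prod_pair hij]
  refine Finset.prod_dvd_prod_of_subset _ _ _ ?_
  intro k hk
  simp only [Finset.mem_insert, Finset.mem_singleton] at hk
  rcases hk with rfl | rfl <;> assumption

/-- the power of the product of all `t - x_k` -/
noncomputable def Rn (K : Type) [Field K] (ℓ n : ℕ) : Polynomial (MvPolynomial (Fin ℓ) K) :=
  ∏ k : Fin ℓ, (Polynomial.X - Polynomial.C (X k)) ^ n

theorem Rn_ne (n : ℕ) : Rn K ℓ n ≠ 0 := by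
  rw [Rn, Finset.prod_ne_zero_iff]
  exact fun k _ => pow_ne_zero _ (Polynomial.X_sub_C_ne_zero _)

theorem Rn_dvd (n : ℕ) (i : Fin ℓ) :
    (Polynomial.X - Polynomial.C (X i)) ^ n ∣ Rn K ℓ n :=
  Finset.dvd_prod_of_mem
    (fun k : Fin ℓ => (Polynomial.X - Polynomial.C (X k : MvPolynomial (Fin ℓ) K)) ^ n)
    (Finset.mem_univ i)

theorem Rn_dvd_two (n : ℕ) {i j : Fin ℓ} (hij : i ≠ j) :
    (Polynomial.X - Polynomial.C (X i)) ^ n * (Polynomial.X - Polynomial.C (X j)) ^ n ∣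
      Rn K ℓ n :=
  two_dvd_prod
    (fun k : Fin ℓ => (Polynomial.X - Polynomial.C (X k : MvPolynomial (Fin ℓ) K)) ^ n)
    Finset.univ hij (Finset.mem_univ i) (Finset.mem_univ j)

theorem Rn_hd (n : ℕ) : HD (Rn K ℓ n) (n * ℓ) := by
  have := HD.prod Finset.univ
    (fun k : Fin ℓ => (Polynomial.X - Polynomial.C (X k : MvPolynomial (Fin ℓ) K)) ^ n) (n * 1)
    (fun k _ => (HD.X_sub k).pow n)
  rwa [Finset.card_univ, Fintype.card_fin, mul_one, mul_comm] at this

theorem sum_fin_two (ℓ : ℕ) : 2 * ∑ i : Fin ℓ, (i : ℕ) = ℓ * (ℓ - 1) := by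
  rw [Fin.sum_univ_eq_sum_range (fun i => i), mul_comm, Finset.sum_range_id_mul_two]

theorem sum_ite_zero [NeZero ℓ] (c : ℕ) :
    ∑ a : Fin ℓ, (if a = 0 then 0 else c) = (ℓ - 1) * c := by
  rw [← Finset.add_sum_erase _ _ (Finset.mem_univ (0 : Fin ℓ)), if_pos rfl, zero_add,
    Finset.sum_congr rfl (fun a ha => if_neg (Finset.ne_of_mem_erase ha)), Finset.sum_const,
    Finset.card_erase_of_mem (Finset.mem_univ _), Finset.card_univ, Fintype.card_fin, smul_eq_mul]

theorem odd_case [NeZero ℓ] (n : ℕ) :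
    ∃ θ : Fin ℓ → Fin ℓ → MvPolynomial (Fin ℓ) K,
      isBasisOf (braidD K ℓ (2 * n + 1)) θ ∧
        ∀ a, homogOf (θ a) (if a = 0 then 0 else n * ℓ + (a - 1 : ℕ) + 1) := by
  refine ⟨_, construct (2 * n + 1) (fun a => n * ℓ + (a - 1 : ℕ)) (fun _ => n)
    (fun a => Rn K ℓ n * Polynomial.X ^ (a - 1 : ℕ)) ?_ ?_ ?_ ?_ ?_ ?_⟩
  · intro a ha i j hij
    refine ⟨n, n, by omega, ?_⟩
    exact (Rn_dvd_two n hij.ne).mul_right _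
  · intro a ha
    have := (Rn_hd (K := K) (ℓ := ℓ) n).mul (HD.X.pow (a - 1 : ℕ))
    rwa [mul_one] at this
  · have h1 : ∀ a : Fin ℓ, (if a = 0 then 0 else n * ℓ + (a - 1 : ℕ) + 1) =
        (if a = 0 then 0 else n * ℓ) + (a : ℕ) := by
      intro a
      split_ifs with h
      · simp [h]
      · have := Fin.val_ne_zero_iff.2 h
        omega
    rw [Finset.sum_congr rfl fun a _ => h1 a, Finset.sum_add_distrib, sum_ite_zero]
    have := sum_fin_two ℓ
    linear_combination n * this.symm
  · intro a ha i
    exact (Rn_dvd n i).mul_right _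
  · intro a ha
    have := Fin.val_ne_zero_iff.2 ha
    have := a.2
    simp only [Finset.sum_const, Finset.card_univ, Fintype.card_fin, smul_eq_mul]
    have : ℓ * (n + 1) = n * ℓ + ℓ := by ring
    omega
  · intro v hv a ha
    have h1 : Rn K ℓ n * ∑ b ∈ Finset.univ.erase 0,
        v b • (Polynomial.X ^ (b - 1 : ℕ) : Polynomial (MvPolynomial (Fin ℓ) K)) = 0 := by
      rw [← hv, Finset.mul_sum]
      refine Finset.sum_congr rfl fun b _ => ?_
      rw [mul_smul_comm]
    have h2 := (mul_eq_zero.1 h1).resolve_left (Rn_ne n)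
    have h3 := congrArg (fun q => Polynomial.coeff q (a - 1 : ℕ)) h2
    simp only [Polynomial.finsetSum_coeff, Polynomial.coeff_smul, Polynomial.coeff_X_pow,
      Polynomial.coeff_zero] at h3
    rw [Finset.sum_eq_single a] at h3
    · simpa using h3
    · intro b hb hba
      have hb' := Fin.val_ne_zero_iff.2 (Finset.ne_of_mem_erase hb)
      have ha' := Fin.val_ne_zero_iff.2 ha
      have : (b : ℕ) ≠ a := fun h => hba (Fin.ext h)
      rw [if_neg (by omega), smul_zero]
    · intro h
      exact absurd (Finset.mem_erase.2 ⟨ha, Finset.mem_univ a⟩) h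

theorem even_case [NeZero ℓ] (n : ℕ) :
    ∃ θ : Fin ℓ → Fin ℓ → MvPolynomial (Fin ℓ) K,
      isBasisOf (braidD K ℓ (2 * n + 2)) θ ∧
        ∀ a, homogOf (θ a) (if a = 0 then 0 else n * ℓ + (ℓ - 1) + 1) := by
  have hℓ : 0 < ℓ := Nat.pos_of_ne_zero (NeZero.ne ℓ)
  refine ⟨_, construct (2 * n + 2) (fun a => n * ℓ + (ℓ - 1)) (fun i => if i = 0 then n + 1 else n)
    (fun a => Rn K ℓ n * ∏ k ∈ Finset.univ.erase a, (Polynomial.X - Polynomial.C (X k)))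
    ?_ ?_ ?_ ?_ ?_ ?_⟩
  · intro a ha i j hij
    have h1 : (Polynomial.X - Polynomial.C (X i)) ^ n * (Polynomial.X - Polynomial.C (X j)) ^ n ∣
        Rn K ℓ n := Rn_dvd_two n hij.ne
    by_cases hai : i = a
    · refine ⟨n, n + 1, by omega, ?_⟩
      rw [pow_succ, ← mul_assoc]
      refine mul_dvd_mul h1 (Finset.dvd_prod_of_mem
        (fun k : Fin ℓ => (Polynomial.X - Polynomial.C (X k : MvPolynomial (Fin ℓ) K))) ?_)
      rw [Finset.mem_erase]
      exact ⟨fun h => hij.ne (hai.trans h.symm), Finset.mem_univ _⟩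
    · refine ⟨n + 1, n, by omega, ?_⟩
      rw [pow_succ, mul_right_comm]
      refine mul_dvd_mul h1 (Finset.dvd_prod_of_mem
        (fun k : Fin ℓ => (Polynomial.X - Polynomial.C (X k : MvPolynomial (Fin ℓ) K))) ?_)
      rw [Finset.mem_erase]
      exact ⟨hai, Finset.mem_univ _⟩
  · intro a ha
    have := (Rn_hd (K := K) (ℓ := ℓ) n).mul
      (HD.prod (Finset.univ.erase a) _ 1 (fun k _ => HD.X_sub k))
    rwa [mul_one, Finset.card_erase_of_mem (Finset.mem_univ _), Finset.card_univ,
      Fintype.card_fin] at this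
  · rw [sum_ite_zero]
    have := sum_fin_two ℓ
    have h2 : n * ℓ + (ℓ - 1) + 1 = (n + 1) * ℓ := by
      rw [Nat.succ_mul]; omega
    rw [h2]
    linear_combination (n + 1) * this.symm
  · intro a ha i
    have h1 : (Polynomial.X - Polynomial.C (X i)) ^ n ∣ Rn K ℓ n := Rn_dvd n i
    by_cases hi : i = 0
    · rw [if_pos hi, pow_succ]
      refine mul_dvd_mul h1 (Finset.dvd_prod_of_mem
        (fun k : Fin ℓ => (Polynomial.X - Polynomial.C (X k : MvPolynomial (Fin ℓ) K))) ?_)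
      rw [Finset.mem_erase]
      exact ⟨fun h => ha (h.symm.trans hi), Finset.mem_univ _⟩
    · rw [if_neg hi]
      exact h1.mul_right _
  · intro a ha
    have h1 : ∀ i : Fin ℓ, (if i = 0 then n + 1 else n) + 1 = (n + 1) + if i = 0 then 1 else 0 := by
      intro i; split_ifs <;> ring
    rw [Finset.sum_congr rfl fun i _ => h1 i, Finset.sum_add_distrib, Finset.sum_ite_eq']
    simp only [Finset.sum_const, Finset.card_univ, Fintype.card_fin, smul_eq_mul, Finset.mem_univ,
      if_true]
    have : ℓ * (n + 1) = n * ℓ + ℓ := by ring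
    omega
  · intro v hv a ha
    have h1 : Rn K ℓ n * ∑ b ∈ Finset.univ.erase 0,
        v b • (∏ k ∈ Finset.univ.erase b, (Polynomial.X - Polynomial.C (X k)) :
          Polynomial (MvPolynomial (Fin ℓ) K)) = 0 := by
      rw [← hv, Finset.mul_sum]
      refine Finset.sum_congr rfl fun b _ => ?_
      rw [mul_smul_comm]
    have h2 := (mul_eq_zero.1 h1).resolve_left (Rn_ne n)
    have h3 := congrArg (Polynomial.eval (X a)) h2
    simp only [Polynomial.eval_finsetSum, Polynomial.eval_smul, Polynomial.eval_prod,
      Polynomial.eval_zero, Polynomial.eval_sub, Polynomial.eval_X, Polynomial.eval_C] at h3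
    rw [Finset.sum_eq_single a] at h3
    · rw [smul_eq_mul] at h3
      refine (mul_eq_zero.1 h3).resolve_right ?_
      refine Finset.prod_ne_zero_iff.2 ?_
      exact fun k hk => X_sub_X_ne (Finset.ne_of_mem_erase hk).symm
    · intro b hb hba
      rw [Finset.prod_eq_zero (Finset.mem_erase.2 ⟨hba.symm, Finset.mem_univ a⟩) (sub_self _),
        smul_zero]
    · intro h
      exact absurd (Finset.mem_erase.2 ⟨ha, Finset.mem_univ a⟩) h
end hom

/-- Terao's theorem for type `A` (inductive freeness aside): the braid arrangement
`B_ℓ = Φ₁ × A_{ℓ-1}` in `K^ℓ` with constant multiplicity `m ≥ 1` is free; besides the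
exponent `0` of the trivial factor, the exponents of the essential part `A_{ℓ-1}` are
`{mℓ/2, …, mℓ/2}` (`ℓ-1` copies) for `m` even and
`{(m-1)ℓ/2 + 1, …, (m-1)ℓ/2 + ℓ - 1}` for `m` odd. -/
theorem stmt6 {K : Type} [Field K] [CharZero K] (ℓ m : ℕ) (hℓ : 2 ≤ ℓ) (hm : 1 ≤ m) :
    (Even m → ∃ θ : Fin ℓ → Fin ℓ → MvPolynomial (Fin ℓ) K,
        isBasisOf (braidD K ℓ m) θ ∧
        ∀ j : Fin ℓ, homogOf (θ j) (if (j : ℕ) = 0 then 0 else m * ℓ / 2)) ∧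
    (Odd m → ∃ θ : Fin ℓ → Fin ℓ → MvPolynomial (Fin ℓ) K,
        isBasisOf (braidD K ℓ m) θ ∧
        ∀ j : Fin ℓ, homogOf (θ j) (if (j : ℕ) = 0 then 0 else (m - 1) * ℓ / 2 + (j : ℕ))) := by
  have : NeZero ℓ := ⟨by omega⟩
  constructor
  · rintro ⟨r, hr⟩
    obtain ⟨n, rfl⟩ : ∃ n, r = n + 1 := ⟨r - 1, by omega⟩
    obtain rfl : m = 2 * n + 2 := by omega
    obtain ⟨θ, h1, h2⟩ := even_case (K := K) (ℓ := ℓ) n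
    refine ⟨θ, h1, fun j => ?_⟩
    have h3 := h2 j
    have h4 : n * ℓ + (ℓ - 1) + 1 = (2 * n + 2) * ℓ / 2 := by
      have : (2 * n + 2) * ℓ = 2 * (n * ℓ + ℓ) := by ring
      omega
    rw [h4] at h3
    simpa only [Fin.val_eq_zero_iff] using h3
  · rintro ⟨n, rfl⟩
    obtain ⟨θ, h1, h2⟩ := odd_case (K := K) (ℓ := ℓ) n
    refine ⟨θ, h1, fun j => ?_⟩
    have h3 := h2 j
    by_cases hj : (j : ℕ) = 0
    · rw [if_pos hj]
      rwa [if_pos (Fin.val_eq_zero_iff.1 hj)] at h3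
    · rw [if_neg hj]
      rw [if_neg (fun h => hj (Fin.val_eq_zero_iff.2 h))] at h3
      have h4 : n * ℓ + ((j : ℕ) - 1) + 1 = (2 * n + 1 - 1) * ℓ / 2 + j := by
        have : (2 * n + 1 - 1) * ℓ = 2 * (n * ℓ) := by rw [Nat.add_sub_cancel]; ring
        omega
      rwa [h4] at h3
end

section
/- For the Coxeter arrangement A of type A_{ℓ-1} with constant multiplicity m, H_0 = ker(x_1 - x_2), and deletion ν' increasing ν(H_0) to m+1: the Euler multiplicity ν* on the restriction to H_0 satisfies ν*(Y) = ⌊(3m+1)/2⌋ at each triple point Y = {x_1 = x_2 = x_a} (a ≥ 3) when m ≥ 1, and ν*(Y) = m at each point Y = {x_1 = x_2, x_b = x_c} with 3 ≤ b < c. -/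
open MvPolynomial

/-- The localized module `D(A_Y, ν_Y)` has a canonical homogeneous basis with a distinguished
element `θ_Y ∉ α₀·Der S` of polynomial degree `e` (the Euler multiplicity), an element
`ψ_Y ∈ α₀·Der S`, and the remaining elements of degree 0. -/
def eulerW {K : Type} [Field K] {ℓ : ℕ}
    (D : (Fin ℓ → MvPolynomial (Fin ℓ) K) → Prop)
    (a₀ : MvPolynomial (Fin ℓ) K) (e : ℕ) : Prop :=
  ∃ B : Fin ℓ → Fin ℓ → MvPolynomial (Fin ℓ) K, ∃ d : Fin ℓ → ℕ,
    isBasisOf D B ∧ (∀ k, homogOf (B k) (d k)) ∧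
    ∃ k₀ k₁ : Fin ℓ, k₀ ≠ k₁ ∧
      ¬ (∀ t, a₀ ∣ B k₀ t) ∧ d k₀ = e ∧
      (∀ t, a₀ ∣ B k₁ t) ∧
      (∀ k, k ≠ k₀ → k ≠ k₁ → d k = 0)

/-- Normality of the diagonal Padé table of `t ^ m` at `t = 1`. -/
lemma pade_normal {K : Type} [Field K] [CharZero K] (m k : ℕ) (hk : k + 1 ≤ m)
    (u v : Polynomial K) (hu : u.natDegree ≤ k) (hv : v.natDegree ≤ k)
    (h : (Polynomial.X - 1 : Polynomial K) ^ (2 * k + 2) ∣ Polynomial.X ^ m * u - v) :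
    u = 0 ∧ v = 0 := by
  have hu0 : u = 0 := by
    by_contra hne
    set f : Polynomial K := Polynomial.X ^ m * u with hf
    have hdeg : f.natDegree = m + u.natDegree := by
      rw [hf, Polynomial.natDegree_mul (pow_ne_zero _ Polynomial.X_ne_zero) hne,
        Polynomial.natDegree_X_pow]
    have h1 := Polynomial.pow_sub_dvd_iterate_derivative_of_pow_dvd (k + 1) h
    rw [Polynomial.iterate_derivative_sub,
      Polynomial.iterate_derivative_eq_zero (p := v) (by omega), sub_zero,
      show 2 * k + 2 - (k + 1) = k + 1 by omega] at h1
    have h2 : (Polynomial.X : Polynomial K) ^ (m - (k + 1)) ∣ Polynomial.derivative^[k + 1] f :=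
      Polynomial.pow_sub_dvd_iterate_derivative_of_pow_dvd (k + 1) (Dvd.intro _ rfl)
    have hc : IsCoprime ((Polynomial.X - 1 : Polynomial K) ^ (k + 1))
        (Polynomial.X ^ (m - (k + 1))) := by
      apply IsCoprime.pow
      exact ⟨-1, 1, by ring⟩
    have h3 := hc.mul_dvd h1 h2
    have hX1 : (Polynomial.X - 1 : Polynomial K) = Polynomial.X - Polynomial.C 1 := by simp
    have hnd : ((Polynomial.X - 1 : Polynomial K) ^ (k + 1) *
        Polynomial.X ^ (m - (k + 1))).natDegree = m := by
      rw [hX1, Polynomial.natDegree_mul (pow_ne_zero _ (Polynomial.X_sub_C_ne_zero 1))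
        (pow_ne_zero _ Polynomial.X_ne_zero), Polynomial.natDegree_pow,
        Polynomial.natDegree_X_sub_C, Polynomial.natDegree_X_pow]
      omega
    have h4 : Polynomial.derivative^[k + 1] f = 0 := by
      apply Polynomial.eq_zero_of_dvd_of_natDegree_lt h3
      rw [hnd]
      have := Polynomial.natDegree_iterate_derivative f (k + 1)
      omega
    have h5 := Polynomial.coeff_iterate_derivative (k := k + 1) f (f.natDegree - (k + 1))
    rw [h4, Polynomial.coeff_zero, show f.natDegree - (k + 1) + (k + 1) = f.natDegree by omega,
      eq_comm, smul_eq_zero, Nat.descFactorial_eq_zero_iff_lt] at h5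
    rcases h5 with h5 | h5
    · omega
    · rw [Polynomial.coeff_natDegree, Polynomial.leadingCoeff_eq_zero] at h5
      exact (mul_ne_zero (pow_ne_zero _ Polynomial.X_ne_zero) hne) h5
  refine ⟨hu0, ?_⟩
  rw [hu0, mul_zero, zero_sub, dvd_neg] at h
  apply Polynomial.eq_zero_of_dvd_of_natDegree_lt h
  have hX1 : (Polynomial.X - 1 : Polynomial K) = Polynomial.X - Polynomial.C 1 := by simp
  rw [hX1, Polynomial.natDegree_pow, Polynomial.natDegree_X_sub_C]
  omega

/-- The recursive construction of the pair of (one variable) basis elements. -/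
lemma pade_pair {K : Type} [Field K] [CharZero K] (m n : ℕ) (hn : n ≤ m) :
    ∃ (u v u' v' q q' : Polynomial K) (c : K), c ≠ 0 ∧
      u.natDegree ≤ (n + 1) / 2 ∧ v.natDegree ≤ (n + 1) / 2 ∧
      u'.natDegree ≤ n / 2 ∧ v'.natDegree ≤ n / 2 ∧
      Polynomial.X ^ m * u - v = (Polynomial.X - 1) ^ (n + 1) * q ∧
      Polynomial.X ^ m * u' - v' = (Polynomial.X - 1) ^ n * q' ∧
      u * v' - u' * v = Polynomial.C c * (Polynomial.X - 1) ^ n := by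
  induction n with
  | zero =>
    obtain ⟨q, hq⟩ : (Polynomial.X - 1 : Polynomial K) ∣ Polynomial.X ^ m - 1 := by
      simpa using sub_dvd_pow_sub_pow (Polynomial.X : Polynomial K) 1 m
    refine ⟨1, 1, 0, 1, q, -1, 1, one_ne_zero, ?_⟩
    simp [hq]
  | succ n ih =>
    obtain ⟨u, v, u', v', q, q', c, hc, hu, hv, hu', hv', h, h', hdet⟩ := ih (by omega)
    have hX1 : (Polynomial.X - 1 : Polynomial K) = Polynomial.X - Polynomial.C 1 := by simp
    have hd : ∀ (w : Polynomial K) (e : ℕ), w.natDegree ≤ e →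
        ((Polynomial.X - 1) * w).natDegree ≤ e + 1 := by
      intro w e hw
      refine (Polynomial.natDegree_mul_le).trans ?_
      rw [hX1, Polynomial.natDegree_X_sub_C]
      omega
    by_cases hr : q.eval 1 = 0
    · obtain ⟨q₁, hq₁⟩ : (Polynomial.X - 1 : Polynomial K) ∣ q := by
        rw [hX1]; exact Polynomial.dvd_iff_isRoot.mpr hr
      rcases Nat.even_or_odd' n with ⟨j, rfl | rfl⟩
      · exfalso
        obtain ⟨h1, h2⟩ := pade_normal m j (by omega) u v (by omega) (by omega)
          ⟨q₁, by rw [h, hq₁]; ring⟩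
        rw [h1, h2] at hdet
        have : Polynomial.C c * (Polynomial.X - 1) ^ (2 * j) ≠ (0 : Polynomial K) := by
          rw [hX1]
          exact mul_ne_zero (by simpa using hc) (pow_ne_zero _ (Polynomial.X_sub_C_ne_zero 1))
        apply this
        rw [← hdet]; ring
      · refine ⟨u, v, (Polynomial.X - 1) * u', (Polynomial.X - 1) * v', q₁, q', c, hc,
          by omega, by omega, (hd _ _ hu').trans (by omega), (hd _ _ hv').trans (by omega),
          ?_, ?_, ?_⟩
        · rw [h, hq₁]; ring
        · linear_combination (Polynomial.X - 1) * h'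
        · linear_combination (Polynomial.X - 1) * hdet
    · set l : K := q'.eval 1 / q.eval 1 with hl
      obtain ⟨q₁, hq₁⟩ : (Polynomial.X - 1 : Polynomial K) ∣ q' - Polynomial.C l * q := by
        rw [hX1]; apply Polynomial.dvd_iff_isRoot.mpr
        simp [hl, hr]
      have hd2 : ∀ w w' : Polynomial K, w.natDegree ≤ (n + 1) / 2 → w'.natDegree ≤ n / 2 →
          ((Polynomial.X - 1) * w' - Polynomial.C l * w).natDegree ≤ (n + 1 + 1) / 2 := by
        intro w w' hw hw'
        refine (Polynomial.natDegree_sub_le _ _).trans (max_le ?_ ?_)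
        · exact (hd _ _ hw').trans (by omega)
        · exact (Polynomial.natDegree_C_mul_le _ _).trans (by omega)
      refine ⟨(Polynomial.X - 1) * u' - Polynomial.C l * u,
        (Polynomial.X - 1) * v' - Polynomial.C l * v, u, v, q₁, q, -c, neg_ne_zero.mpr hc,
        hd2 _ _ hu hu', hd2 _ _ hv hv', hu, hv, ?_, h, ?_⟩
      · linear_combination (Polynomial.X - 1) * h' - Polynomial.C l * h
          + (Polynomial.X - 1) ^ (n + 1) * hq₁
      · rw [Polynomial.C_neg]
        linear_combination -(Polynomial.X - 1) * hdet

/-- Homogenized version: the polynomials `U, V, U', V'` in two elements `x, y`. -/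
lemma pade_homog {K : Type} [Field K] [CharZero K] {ℓ : ℕ} (m : ℕ) (hm : 1 ≤ m)
    (x y : MvPolynomial (Fin ℓ) K) (hx : x.IsHomogeneous 1) (hy : y.IsHomogeneous 1) :
    ∃ (U V U' V' Q Q' : MvPolynomial (Fin ℓ) K) (c : K), c ≠ 0 ∧
      U.IsHomogeneous ((m + 1) / 2) ∧ V.IsHomogeneous ((m + 1) / 2) ∧
      U'.IsHomogeneous (m / 2) ∧ V'.IsHomogeneous (m / 2) ∧
      x ^ m * U - y ^ m * V = (x - y) ^ (m + 1) * Q ∧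
      x ^ m * U' - y ^ m * V' = (x - y) ^ m * Q' ∧
      U * V' - U' * V = C c * (x - y) ^ m ∧
      ∀ z : Fin ℓ → K, eval z x = 1 → eval z y = 1 → eval z U ≠ 0 := by
  obtain ⟨u, v, u', v', q, q', c, hc, hu, hv, hu', hv', h, h', hdet⟩ :=
    pade_pair (K := K) m m le_rfl
  have hX1 : (Polynomial.X - 1 : Polynomial K) = Polynomial.X - Polynomial.C 1 := by simp
  let H : Polynomial K → ℕ → MvPolynomial (Fin ℓ) K := fun p n =>
    aeval ![x, y] (p.homogenize n)
  have Hmul : ∀ (p r : Polynomial K) (a b : ℕ), p.natDegree ≤ a → r.natDegree ≤ b →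
      H (p * r) (a + b) = H p a * H r b := by
    intro p r a b ha hb
    simp [H, Polynomial.homogenize_mul p r ha hb]
  have Hsub : ∀ (p r : Polynomial K) (a : ℕ), H (p - r) a = H p a - H r a := by
    intro p r a
    simp [H]
  have HX : ∀ n, H (Polynomial.X ^ n) n = x ^ n := by
    intro n
    simp [H]
  have H1 : ∀ n, H 1 n = y ^ n := by
    intro n
    simp [H]
  have HC : ∀ (e : K) n, H (Polynomial.C e) n = C e * y ^ n := by
    intro e n
    simp [H, MvPolynomial.algebraMap_eq]
  have hdegpow : ∀ n, ((Polynomial.X - 1 : Polynomial K) ^ n).natDegree = n := by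
    intro n
    rw [hX1, Polynomial.natDegree_pow, Polynomial.natDegree_X_sub_C, mul_one]
  have Hpow : ∀ n, H ((Polynomial.X - 1) ^ n) n = (x - y) ^ n := by
    intro n
    induction n with
    | zero => simp [H1]
    | succ n ih =>
      rw [pow_succ, Hmul _ _ n 1 (hdegpow n).le (by simpa using (hdegpow 1).le), ih, pow_succ, Hsub]
      congr 2
      · simpa using HX 1
      · simpa using H1 1
  have Hhom : ∀ p n, (H p n).IsHomogeneous n := by
    intro p n
    have := (Polynomial.isHomogeneous_homogenize (n := n) p).aeval ![x, y] (n := 1)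
      (by intro i; fin_cases i <;> simpa)
    rw [one_mul] at this
    exact this
  have key : ∀ (u v q : Polynomial K) (d n : ℕ), u.natDegree ≤ d → v.natDegree ≤ d → n ≤ m + d →
      Polynomial.X ^ m * u - v = (Polynomial.X - 1) ^ n * q →
      x ^ m * H u d - y ^ m * H v d = (x - y) ^ n * H q (m + d - n) := by
    intro u v q d n hu hv hn h
    have hq : q.natDegree ≤ m + d - n := by
      by_cases hq0 : q = 0
      · simp [hq0]
      have e1 : ((Polynomial.X - 1) ^ n * q).natDegree = n + q.natDegree := by
        rw [Polynomial.natDegree_mul _ hq0, hdegpow]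
        rw [hX1]; exact pow_ne_zero _ (Polynomial.X_sub_C_ne_zero 1)
      have e2 : (Polynomial.X ^ m * u - v).natDegree ≤ m + d := by
        refine (Polynomial.natDegree_sub_le _ _).trans (max_le ?_ (by omega))
        refine (Polynomial.natDegree_mul_le).trans ?_
        rw [Polynomial.natDegree_X_pow]; omega
      rw [h, e1] at e2
      omega
    have e := congrArg (fun p => H p (m + d)) h
    simp only [Hsub] at e
    rw [Hmul (Polynomial.X ^ m) u m d (by simp) hu, HX] at e
    have e3 : H v (m + d) = y ^ m * H v d := by
      rw [← H1, ← Hmul 1 v m d (by simp) hv, one_mul]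
    rw [e3] at e
    rw [e, show m + d = n + (m + d - n) by omega, Hmul _ _ _ _ (hdegpow n).le hq, Hpow]
    congr 2
    omega
  refine ⟨H u ((m + 1) / 2), H v ((m + 1) / 2), H u' (m / 2), H v' (m / 2),
    H q (m + (m + 1) / 2 - (m + 1)), H q' (m + m / 2 - m), c, hc, Hhom _ _, Hhom _ _, Hhom _ _,
    Hhom _ _, ?_, key _ _ _ _ _ hu' hv' (by omega) h', ?_, ?_⟩
  · rcases Nat.eq_zero_or_pos m with rfl | hm
    · omega
    · exact key _ _ _ _ _ hu hv (by omega) h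
  · have hs : (m + 1) / 2 + m / 2 = m := by omega
    have e := congrArg (fun p => H p m) hdet
    simp only [Hsub] at e
    have e1 : H (u * v') m = H u ((m + 1) / 2) * H v' (m / 2) := by
      rw [← Hmul _ _ _ _ hu hv', hs]
    have e2 : H (u' * v) m = H u' (m / 2) * H v ((m + 1) / 2) := by
      rw [← Hmul _ _ _ _ hu' hv, add_comm, hs]
    have e3 : H (Polynomial.C c * (Polynomial.X - 1) ^ m) m = C c * (x - y) ^ m := by
      have := Hmul (Polynomial.C c) ((Polynomial.X - 1) ^ m) 0 m (by simp) (hdegpow m).le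
      rw [zero_add] at this
      rw [this, HC, Hpow]; simp
    rw [e1, e2, e3] at e
    exact e
  · intro z hzx hzy
    have hu1 : u.eval 1 ≠ 0 := by
      intro h0
      have e : (Polynomial.X - 1) ^ m * Polynomial.C c =
          (Polynomial.X - 1) ^ m * (-(q' * u) + (Polynomial.X - 1) * q * u') := by
        linear_combination -hdet - u * h' + u' * h
      have hne : (Polynomial.X - 1 : Polynomial K) ^ m ≠ 0 := by
        rw [hX1]; exact pow_ne_zero _ (Polynomial.X_sub_C_ne_zero 1)
      have e' := congrArg (Polynomial.eval 1) (mul_left_cancel₀ hne e)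
      simp [h0] at e'
      exact hc e'
    have e : eval z (H u ((m + 1) / 2)) = u.eval 1 := by
      have := Polynomial.aeval_homogenize_of_eq_one (p := u) hu ![(1 : K), 1] (by simp)
      simp only [H]
      rw [show eval z (aeval ![x, y] (u.homogenize ((m + 1) / 2))) =
        aeval ![(1 : K), 1] (u.homogenize ((m + 1) / 2)) from ?_, this]
      · simp [Polynomial.coe_aeval_eq_eval]
      · rw [← MvPolynomial.aeval_eq_eval, ← AlgHom.comp_apply, MvPolynomial.comp_aeval]
        congr 2
        funext i
        fin_cases i <;> simp [MvPolynomial.aeval_eq_eval, hzx, hzy]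
    rw [e]; exact hu1

lemma prime_X_sub_X {K : Type} [Field K] {ℓ : ℕ} (i j : Fin ℓ) (hij : i ≠ j) :
    Prime (X i - X j : MvPolynomial (Fin ℓ) K) := by
  have hne : (X i - X j : MvPolynomial (Fin ℓ) K) ≠ 0 := by
    rw [sub_ne_zero]
    exact fun h => hij (X_injective h)
  have hh : (X i - X j : MvPolynomial (Fin ℓ) K).IsHomogeneous 1 :=
    (isHomogeneous_X K i).sub (isHomogeneous_X K j)
  refine (irreducible_of_totalDegree_eq_one (hh.totalDegree hne) ?_).prime
  intro x hx
  rw [isUnit_iff_ne_zero]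
  rintro rfl
  apply hne
  ext d
  simpa using hx d

lemma not_dvd_of_eval {K : Type} [Field K] {ℓ : ℕ} (p q : MvPolynomial (Fin ℓ) K)
    (z : Fin ℓ → K) (hp : eval z p = 0) (hq : eval z q ≠ 0) : ¬ p ∣ q := by
  rintro ⟨r, rfl⟩
  simp [hp] at hq

/-- Expanding a combination of vectors that are coordinate vectors outside `s`. -/
lemma sum_eval {K : Type} [Field K] {ℓ : ℕ} (s : Finset (Fin ℓ))
    (B : Fin ℓ → Fin ℓ → MvPolynomial (Fin ℓ) K)
    (hB : ∀ k, k ∉ s → B k = Pi.single k 1) (c : Fin ℓ → MvPolynomial (Fin ℓ) K) (t : Fin ℓ) :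
    (∑ k, c k • B k) t = ∑ k ∈ s, c k * B k t + if t ∈ s then 0 else c t := by
  rw [Finset.sum_apply, ← Finset.sum_add_sum_compl s]
  congr 1
  have : ∀ k ∈ sᶜ, (c k • B k) t = if t = k then c k else 0 := by
    intro k hk
    rw [hB k (by simpa using hk)]
    simp [Pi.single_apply]
  rw [Finset.sum_congr rfl this, Finset.sum_ite_eq]
  by_cases h : t ∈ s <;> simp [h]

lemma euler_triple {K : Type} [Field K] [CharZero K] {ℓ : ℕ} (m : ℕ) (hm : 1 ≤ m)
    (i j a : Fin ℓ) (hij : i ≠ j) (hia : i ≠ a) (hja : j ≠ a) :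
    eulerW (fun f : Fin ℓ → MvPolynomial (Fin ℓ) K =>
          (X i - X j : MvPolynomial (Fin ℓ) K) ^ (m + 1) ∣ f i - f j ∧
          (X i - X a : MvPolynomial (Fin ℓ) K) ^ m ∣ f i - f a ∧
          (X j - X a : MvPolynomial (Fin ℓ) K) ^ m ∣ f j - f a)
        (X i - X j) ((3 * m + 1) / 2) := by
  have hom : ∀ p q : Fin ℓ, (X p - X q : MvPolynomial (Fin ℓ) K).IsHomogeneous 1 := fun p q =>
    (isHomogeneous_X K p).sub (isHomogeneous_X K q)
  have hPr := prime_X_sub_X (K := K) i j hij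
  obtain ⟨U, V, U', V', Q, Q', c, hc, hU, hV, hU', hV', h, h', hdet, hev⟩ :=
    pade_homog (K := K) m hm (X i - X a) (X j - X a) (hom i a) (hom j a)
  set x : MvPolynomial (Fin ℓ) K := X i - X a with hx
  set y : MvPolynomial (Fin ℓ) K := X j - X a with hy
  set α : MvPolynomial (Fin ℓ) K := X i - X j with hα
  have hxy : x - y = α := by rw [hx, hy, hα]; ring
  rw [hxy] at h h' hdet
  have homα : α.IsHomogeneous 1 := hom i j
  have homx : x.IsHomogeneous 1 := hom i a
  have homy : y.IsHomogeneous 1 := hom j a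
  have hji := hij.symm
  have hai := hia.symm
  have haj := hja.symm
  have hx0 : x ^ m ≠ 0 := pow_ne_zero _ (prime_X_sub_X i a hia).ne_zero
  have hy0 : y ^ m ≠ 0 := pow_ne_zero _ (prime_X_sub_X j a hja).ne_zero
  -- the evaluation point
  let z : Fin ℓ → K := fun t => if t = a then 0 else 1
  have hzx : eval z x = 1 := by simp [hx, z, hia]
  have hzy : eval z y = 1 := by simp [hy, z, hja]
  have hzα : eval z α = 0 := by simp [hα, z, hia, hja]
  have hαy : ¬ α ∣ y ^ m := not_dvd_of_eval _ _ z hzα (by simp [hzy])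
  let B : Fin ℓ → Fin ℓ → MvPolynomial (Fin ℓ) K := fun k t =>
    if k = i then (if t = i then x ^ m * U else if t = j then y ^ m * V else 0)
    else if k = j then
      (if t = i then α * (x ^ m * U') else if t = j then α * (y ^ m * V') else 0)
    else if k = a then (if t = i ∨ t = j ∨ t = a then 1 else 0)
    else if t = k then 1 else 0
  have hB : ∀ k, k ∉ ({i, j, a} : Finset (Fin ℓ)) → B k = Pi.single k 1 := by
    intro k hk
    simp only [Finset.mem_insert, Finset.mem_singleton, not_or] at hk
    funext t
    simp [B, hk, Pi.single_apply]
  have hsum : ∀ (e : Fin ℓ → MvPolynomial (Fin ℓ) K) (t : Fin ℓ), (∑ k, e k • B k) t =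
      e i * B i t + (e j * B j t + e a * B a t) +
        if t ∈ ({i, j, a} : Finset (Fin ℓ)) then 0 else e t := by
    intro e t
    rw [sum_eval _ B hB, Finset.sum_insert (by simp [hij, hia]), Finset.sum_insert (by simp [hja]),
      Finset.sum_singleton]
  have hsi : ∀ e : Fin ℓ → MvPolynomial (Fin ℓ) K, (∑ k, e k • B k) i =
      x ^ m * (e i * U + e j * (α * U')) + e a := by
    intro e; rw [hsum]; simp [B, hji, hai, haj]; ring
  have hsj : ∀ e : Fin ℓ → MvPolynomial (Fin ℓ) K, (∑ k, e k • B k) j =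
      y ^ m * (e i * V + e j * (α * V')) + e a := by
    intro e; rw [hsum]; simp [B, hji, hai, haj]; ring
  have hsa : ∀ e : Fin ℓ → MvPolynomial (Fin ℓ) K, (∑ k, e k • B k) a = e a := by
    intro e; rw [hsum]; simp [B, hji, hai, haj]
  have hst : ∀ (e : Fin ℓ → MvPolynomial (Fin ℓ) K) (t : Fin ℓ), t ≠ i → t ≠ j → t ≠ a →
      (∑ k, e k • B k) t = e t := by
    intro e t h1 h2 h3; rw [hsum]; simp [B, hji, hai, haj, h1, h2, h3]
  have hαc : C c * α ^ (m + 1) ≠ (0 : MvPolynomial (Fin ℓ) K) :=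
    mul_ne_zero (by simpa using hc) (pow_ne_zero _ hPr.ne_zero)
  refine ⟨B, fun k => if k = i then (3 * m + 1) / 2 else if k = j then 1 + (m + m / 2) else 0,
    ⟨?_, ?_⟩, ?_, i, j, hij, ?_, by simp, ?_, ?_⟩
  · intro k
    by_cases hki : k = i
    · subst hki
      refine ⟨⟨Q, ?_⟩, ⟨U, ?_⟩, ⟨V, ?_⟩⟩ <;> simp [B, hji, hai, haj, h]
    by_cases hkj : k = j
    · subst hkj
      refine ⟨⟨Q', ?_⟩, ⟨α * U', ?_⟩, ⟨α * V', ?_⟩⟩ <;> simp [B, hji, hai, haj]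
      · linear_combination α * h'
      · ring
      · ring
    by_cases hka : k = a
    · subst hka
      simp [B, hai, haj]
    · simp [B, hki, hkj, hka, Ne.symm hki, Ne.symm hkj, Ne.symm hka]
  · rintro g ⟨⟨E, hE⟩, ⟨p, hp⟩, ⟨q, hq⟩⟩
    have hE' : x ^ m * p - y ^ m * q = α ^ (m + 1) * E := by
      rw [← hp, ← hq, ← hE]; ring
    obtain ⟨c0, hc0⟩ : α ^ m ∣ p * V' - q * U' := by
      apply hPr.pow_dvd_of_dvd_mul_left m hαy
      refine ⟨-(p * Q') + U' * (α * E), ?_⟩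
      linear_combination U' * hE' - p * h'
    obtain ⟨c1, hc1⟩ : α ^ (m + 1) ∣ U * q - V * p := by
      apply hPr.pow_dvd_of_dvd_mul_left (m + 1) hαy
      refine ⟨p * Q - U * E, ?_⟩
      linear_combination p * h - U * hE'
    have hCc : C c⁻¹ * C c = (1 : MvPolynomial (Fin ℓ) K) := by
      rw [← C_mul, inv_mul_cancel₀ hc, C_1]
    have s1 : C c⁻¹ * c0 * U + C c⁻¹ * c1 * (α * U') = p := by
      apply mul_left_cancel₀ hαc
      linear_combination (C c * C c⁻¹ * α * U) * (-hc0) + C c * C c⁻¹ * α * U' * (-hc1)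
        + C c * C c⁻¹ * α * p * hdet + C c * α ^ (m + 1) * p * hCc
    have s2 : C c⁻¹ * c0 * V + C c⁻¹ * c1 * (α * V') = q := by
      apply mul_left_cancel₀ hαc
      linear_combination (C c * C c⁻¹ * α * V) * (-hc0) + C c * C c⁻¹ * α * V' * (-hc1)
        + C c * C c⁻¹ * α * q * hdet + C c * α ^ (m + 1) * q * hCc
    refine ⟨fun k => if k = i then C c⁻¹ * c0 else if k = j then C c⁻¹ * c1 else g k, ?_, ?_⟩
    · funext t
      by_cases hti : t = i
      · subst hti
        rw [hsi]
        simp only [hji, hai, haj, if_true, if_false]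
        rw [s1, ← hp]; ring
      by_cases htj : t = j
      · subst htj
        rw [hsj]
        simp only [hji, hai, haj, if_true, if_false]
        rw [s2, ← hq]; ring
      by_cases hta : t = a
      · subst hta
        rw [hsa]
        simp [hai, haj]
      · rw [hst _ _ hti htj hta]
        simp [hti, htj]
    · intro e he
      have ea : g a = e a := by rw [← hsa e, ← he]
      have ei : e i * U + e j * (α * U') = p := by
        apply mul_left_cancel₀ hx0
        rw [← hp, he, hsi, hsa]; ring
      have ej : e i * V + e j * (α * V') = q := by
        apply mul_left_cancel₀ hy0
        rw [← hq, he, hsj, hsa]; ring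
      funext t
      by_cases hti : t = i
      · subst hti
        simp only [if_true]
        apply mul_left_cancel₀ hαc
        linear_combination -(e t * α * hdet) + α * V' * (ei - s1) - α * U' * (ej - s2)
          + C c⁻¹ * c0 * α * hdet
      by_cases htj : t = j
      · subst htj
        simp only [hji, if_true, if_false]
        apply mul_left_cancel₀ hαc
        linear_combination -(e t * α * hdet) + U * (ej - s2) - V * (ei - s1)
          + C c⁻¹ * c1 * α * hdet
      by_cases hta : t = a
      · subst hta
        simp [hai, haj, ea]
      · simp only [hti, htj, if_false]
        rw [he, hst _ _ hti htj hta]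
  · have powhom : ∀ w : MvPolynomial (Fin ℓ) K, w.IsHomogeneous 1 → (w ^ m).IsHomogeneous m := by
      intro w hw
      simpa using hw.pow m
    have e3 : (3 * m + 1) / 2 = m + (m + 1) / 2 := by omega
    intro k t
    by_cases hki : k = i
    · subst hki
      by_cases htk : t = k
      · right; simp only [B, htk, if_true, e3]; exact (powhom _ homx).mul hU
      by_cases htj : t = j
      · right; simp only [B, htj, hji, if_true, if_false, e3]; exact (powhom _ homy).mul hV
      · left; simp [B, htk, htj]
    by_cases hkj : k = j
    · subst hkj
      by_cases hti : t = i
      · right; simp only [B, hti, hji, if_true, if_false]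
        exact homα.mul ((powhom _ homx).mul hU')
      by_cases htk : t = k
      · right; simp only [B, htk, hji, if_true, if_false]
        exact homα.mul ((powhom _ homy).mul hV')
      · left; simp [B, hti, htk]
    · simp only [B, hki, hkj, if_false]
      split_ifs
      all_goals first
        | (left; rfl)
        | (right; exact isHomogeneous_one _ _)
  · intro hall
    refine not_dvd_of_eval α (B i i) z hzα ?_ (hall i)
    simp [B, hzx, hev z hzx hzy]
  · intro t
    simp only [B, hji, if_true, if_false]
    split_ifs
    · exact Dvd.intro _ rfl
    · exact Dvd.intro _ rfl
    · exact dvd_zero _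
  · intro k h1 h2
    simp [h1, h2]

lemma euler_double {K : Type} [Field K] {ℓ : ℕ} (m : ℕ)
    (i j b c : Fin ℓ) (hij : i ≠ j) (hib : i ≠ b) (hic : i ≠ c) (hjb : j ≠ b) (hjc : j ≠ c)
    (hbc : b ≠ c) :
    eulerW (fun f : Fin ℓ → MvPolynomial (Fin ℓ) K =>
          (X i - X j : MvPolynomial (Fin ℓ) K) ^ (m + 1) ∣ f i - f j ∧
          (X b - X c : MvPolynomial (Fin ℓ) K) ^ m ∣ f b - f c)
        (X i - X j) m := by
  have hom : ∀ p q : Fin ℓ, (X p - X q : MvPolynomial (Fin ℓ) K).IsHomogeneous 1 := fun p q =>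
    (isHomogeneous_X K p).sub (isHomogeneous_X K q)
  have hji := hij.symm
  have hbi := hib.symm
  have hci := hic.symm
  have hbj := hjb.symm
  have hcj := hjc.symm
  have hcb := hbc.symm
  have homα := hom i j
  have homβ := hom b c
  have hα0 := (prime_X_sub_X (K := K) i j hij).ne_zero
  have hβ0 := (prime_X_sub_X (K := K) b c hbc).ne_zero
  let z : Fin ℓ → K := fun t => if t = b then 1 else 0
  have hzα : eval z (X i - X j) = 0 := by simp [z, hib, hjb]
  have hzβ : eval z (X b - X c) = 1 := by simp [z, hcb]
  set α : MvPolynomial (Fin ℓ) K := X i - X j with hα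
  set β : MvPolynomial (Fin ℓ) K := X b - X c with hβ
  let B : Fin ℓ → Fin ℓ → MvPolynomial (Fin ℓ) K := fun k t =>
    if k = i then (if t = i then α ^ (m + 1) else 0)
    else if k = j then (if t = i ∨ t = j then 1 else 0)
    else if k = b then (if t = b then β ^ m else 0)
    else if k = c then (if t = b ∨ t = c then 1 else 0)
    else if t = k then 1 else 0
  have hB : ∀ k, k ∉ ({i, j, b, c} : Finset (Fin ℓ)) → B k = Pi.single k 1 := by
    intro k hk
    simp only [Finset.mem_insert, Finset.mem_singleton, not_or] at hk
    funext t
    simp [B, hk, Pi.single_apply]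
  have hsum : ∀ (e : Fin ℓ → MvPolynomial (Fin ℓ) K) (t : Fin ℓ), (∑ k, e k • B k) t =
      e i * B i t + (e j * B j t + (e b * B b t + e c * B c t)) +
        if t ∈ ({i, j, b, c} : Finset (Fin ℓ)) then 0 else e t := by
    intro e t
    rw [sum_eval _ B hB, Finset.sum_insert (by simp [hij, hib, hic]),
      Finset.sum_insert (by simp [hjb, hjc]), Finset.sum_insert (by simp [hbc]),
      Finset.sum_singleton]
  have hsi : ∀ e : Fin ℓ → MvPolynomial (Fin ℓ) K, (∑ k, e k • B k) i =
      e i * α ^ (m + 1) + e j := by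
    intro e; rw [hsum]; simp [B, hij, hib, hic, hji, hbi, hbj, hci, hcj, hcb]
  have hsj : ∀ e : Fin ℓ → MvPolynomial (Fin ℓ) K, (∑ k, e k • B k) j = e j := by
    intro e; rw [hsum]; simp [B, hjb, hjc, hji, hbi, hbj, hci, hcj, hcb]
  have hsb : ∀ e : Fin ℓ → MvPolynomial (Fin ℓ) K, (∑ k, e k • B k) b =
      e b * β ^ m + e c := by
    intro e; rw [hsum]; simp [B, hji, hbi, hbj, hci, hcj, hcb]
  have hsc : ∀ e : Fin ℓ → MvPolynomial (Fin ℓ) K, (∑ k, e k • B k) c = e c := by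
    intro e; rw [hsum]; simp [B, hji, hbi, hbj, hci, hcj, hcb]
  have hst : ∀ (e : Fin ℓ → MvPolynomial (Fin ℓ) K) (t : Fin ℓ), t ≠ i → t ≠ j → t ≠ b → t ≠ c →
      (∑ k, e k • B k) t = e t := by
    intro e t h1 h2 h3 h4; rw [hsum]; simp [B, hji, hbi, hbj, hci, hcj, hcb, h1, h2, h3, h4]
  refine ⟨B, fun k => if k = b then m else if k = i then m + 1 else 0,
    ⟨?_, ?_⟩, ?_, b, i, hbi, ?_, by simp, ?_, ?_⟩
  · intro k
    by_cases hki : k = i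
    · subst hki
      simp [B, hji, hbi, hci]
    by_cases hkj : k = j
    · subst hkj
      simp [B, hji, hbi, hci, hbj, hcj]
    by_cases hkb : k = b
    · subst hkb
      simp [B, hib, hjb, hcb, hki, hkj]
    by_cases hkc : k = c
    · subst hkc
      simp [B, hib, hjb, hic, hjc, hki, hkj, hkb]
    · simp [B, hki, hkj, hkb, hkc, Ne.symm hki, Ne.symm hkj, Ne.symm hkb, Ne.symm hkc]
  · rintro g ⟨⟨p, hp⟩, ⟨q, hq⟩⟩
    refine ⟨fun k => if k = i then p else if k = b then q else g k, ?_, ?_⟩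
    · funext t
      by_cases hti : t = i
      · subst hti
        rw [hsi]
        simp only [hji, hjb, if_true, if_false]
        linear_combination hp
      by_cases htj : t = j
      · subst htj
        rw [hsj]
        simp [hji, hjb]
      by_cases htb : t = b
      · subst htb
        rw [hsb]
        simp only [hbi, hci, hcb, if_true, if_false]
        linear_combination hq
      by_cases htc : t = c
      · subst htc
        rw [hsc]
        simp [hci, hcb]
      · rw [hst _ _ hti htj htb htc]
        simp [hti, htb]
    · intro e he
      have ej : g j = e j := by rw [← hsj e, ← he]
      have ec : g c = e c := by rw [← hsc e, ← he]
      have ei : g i = e i * α ^ (m + 1) + e j := by rw [← hsi e, ← he]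
      have eb : g b = e b * β ^ m + e c := by rw [← hsb e, ← he]
      funext t
      by_cases hti : t = i
      · subst hti
        simp only [if_true]
        apply mul_left_cancel₀ (pow_ne_zero (m + 1) hα0)
        linear_combination hp - ei + ej
      by_cases htb : t = b
      · subst htb
        simp only [hbi, if_true, if_false]
        apply mul_left_cancel₀ (pow_ne_zero m hβ0)
        linear_combination hq - eb + ec
      simp only [hti, htb, if_false]
      by_cases htj : t = j
      · rw [htj, ej]
      by_cases htc : t = c
      · rw [htc, ec]
      · rw [he, hst _ _ hti htj htb htc]
  · intro k t
    by_cases hki : k = i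
    · subst hki
      by_cases htk : t = k
      · right
        simp only [B, htk, hib, if_true, if_false]
        simpa using homα.pow (m + 1)
      · left; simp [B, htk]
    by_cases hkb : k = b
    · subst hkb
      by_cases htk : t = k
      · right
        simp only [B, htk, hbi, hbj, if_true, if_false]
        simpa using homβ.pow m
      · left; simp [B, htk, hbi, hbj]
    · simp only [B, hki, hkb, if_false]
      split_ifs
      all_goals first
        | (left; rfl)
        | (right; exact isHomogeneous_one _ _)
  · intro hall
    refine not_dvd_of_eval α (B b b) z hzα ?_ (hall b)
    simp [B, hbi, hbj, hzβ]
  · intro t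
    simp only [B, if_true]
    split_ifs
    · exact dvd_pow_self _ (by omega)
    · exact dvd_zero _
  · intro k h1 h2
    simp [h1, h2]

/-- For the type `A_{ℓ-1}` arrangement with multiplicity `m+1` on `H₀ = ker(x₁ - x₂)` and `m`
elsewhere, the Euler multiplicity on the restriction to `H₀` is `⌊(3m+1)/2⌋` at each triple
point `{x₁ = x₂ = x_a}` and `m` at each double point `{x₁ = x₂, x_b = x_c}` (`b, c ≥ 3`). -/
theorem stmt13 {K : Type} [Field K] [CharZero K] {ℓ : ℕ} (hℓ : 3 ≤ ℓ) (m : ℕ) (hm : 1 ≤ m) :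
    (∀ a : Fin ℓ, 2 ≤ (a : ℕ) →
      eulerW (fun f : Fin ℓ → MvPolynomial (Fin ℓ) K =>
          (X ⟨0, by omega⟩ - X ⟨1, by omega⟩ : MvPolynomial (Fin ℓ) K) ^ (m + 1)
              ∣ f ⟨0, by omega⟩ - f ⟨1, by omega⟩ ∧
          (X ⟨0, by omega⟩ - X a : MvPolynomial (Fin ℓ) K) ^ m ∣ f ⟨0, by omega⟩ - f a ∧
          (X ⟨1, by omega⟩ - X a : MvPolynomial (Fin ℓ) K) ^ m ∣ f ⟨1, by omega⟩ - f a)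
        (X ⟨0, by omega⟩ - X ⟨1, by omega⟩) ((3 * m + 1) / 2)) ∧
    (∀ b c : Fin ℓ, 2 ≤ (b : ℕ) → b < c →
      eulerW (fun f : Fin ℓ → MvPolynomial (Fin ℓ) K =>
          (X ⟨0, by omega⟩ - X ⟨1, by omega⟩ : MvPolynomial (Fin ℓ) K) ^ (m + 1)
              ∣ f ⟨0, by omega⟩ - f ⟨1, by omega⟩ ∧
          (X b - X c : MvPolynomial (Fin ℓ) K) ^ m ∣ f b - f c)
        (X ⟨0, by omega⟩ - X ⟨1, by omega⟩) m) := by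
  constructor
  · intro a ha
    apply euler_triple m hm
    · simp
    · intro h; simp [← h] at ha
    · intro h; simp [← h] at ha
  · intro b c hb hbc
    have hbc' : (b : ℕ) < c := hbc
    apply euler_double m
    all_goals
      intro h
      have h' := congrArg Fin.val h
      try simp at h'
      try omega
end

section
/- For the mixed multiplicity of type A_1 inside rank 2: the multiarrangement on the Coxeter arrangement of type A_2 in K^3 with defining polynomial (x_1 - x_2)^{m+q}(x_1 - x_3)^{m+q}(x_2 - x_3)^m is free (rank ≤ 2 over the essential quotient plus Euler direction), with essential exponents {3m/2 + q, 3m/2 + q} when m is even. -/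
open MvPolynomial

theorem sparse_zero {K : Type} [Field K] [CharZero K] : ∀ (k : ℕ) (f : Polynomial K),
    f.support.card ≤ k → (Polynomial.X - Polynomial.C 1) ^ k ∣ f → f = 0 := by
  intro k
  induction k with
  | zero => intro f hf _; simpa using hf
  | succ k ih =>
    intro f hf hd
    by_contra hne
    obtain ⟨r, hr⟩ := Finset.nonempty_iff_ne_empty.2 (mt Polynomial.support_eq_empty.1 hne)
    have hco : ∀ e : ℕ, (Polynomial.X * f.derivative - Polynomial.C (r : K) * f).coeff e
        = ((e : K) - r) * f.coeff e := by
      intro e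
      rw [Polynomial.coeff_sub, Polynomial.coeff_C_mul]
      cases e with
      | zero => simp
      | succ e => simp [Polynomial.coeff_X_mul, Polynomial.coeff_derivative]; ring
    have hz : Polynomial.X * f.derivative - Polynomial.C (r : K) * f = 0 := by
      apply ih
      · have : (Polynomial.X * f.derivative - Polynomial.C (r : K) * f).support
            ⊆ f.support.erase r := by
          intro e he
          rw [Polynomial.mem_support_iff, hco] at he
          rw [Finset.mem_erase, Polynomial.mem_support_iff]
          refine ⟨?_, right_ne_zero_of_mul he⟩
          rintro rfl
          simp at he
        have h2 := Finset.card_le_card this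
        rw [Finset.card_erase_of_mem hr] at h2
        omega
      · apply dvd_sub
        · exact Dvd.dvd.mul_left (by simpa using Polynomial.pow_sub_one_dvd_derivative_of_pow_dvd hd) _
        · exact Dvd.dvd.mul_left ((pow_dvd_pow _ (Nat.le_succ k)).trans hd) _
    have hmon : f = Polynomial.monomial r (f.coeff r) := by
      ext e
      rw [Polynomial.coeff_monomial]
      split_ifs with h
      · rw [h]
      · have := hco e
        rw [hz, Polynomial.coeff_zero, eq_comm, mul_eq_zero, sub_eq_zero] at this
        rcases this with h' | h'
        · exact absurd (by exact_mod_cast h'.symm) h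
        · exact h'
    have h1 : Polynomial.eval 1 f = 0 := by
      have : (Polynomial.X - Polynomial.C 1) ∣ f := (dvd_pow_self _ (Nat.succ_ne_zero k)).trans hd
      exact Polynomial.dvd_iff_isRoot.1 this
    rw [hmon] at h1
    simp at h1
    simp [h1] at hr

theorem natDegree_lin_pow {K : Type} [Field K] (N : ℕ) :
    ((Polynomial.X - Polynomial.C (1 : K)) ^ N).natDegree = N := by
  rw [Polynomial.natDegree_pow, Polynomial.natDegree_X_sub_C, mul_one]

theorem exists_sparse {K : Type} [Field K] [CharZero K] (k : ℕ) (E : Finset ℕ)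
    (hE : E.card = k + 1) (e : ℕ) (he : e ∈ E) :
    ∃ f : Polynomial K, f.support ⊆ E ∧ (Polynomial.X - Polynomial.C 1) ^ k ∣ f ∧
      f.coeff e ≠ 0 := by
  let F : (E → K) →ₗ[K] Polynomial K :=
    ∑ i : E, (Polynomial.monomial (i : ℕ)).comp (LinearMap.proj i)
  have hF : ∀ c, F c = ∑ i : E, Polynomial.monomial (i : ℕ) (c i) := by
    intro c; simp [F]
  let T : (E → K) →ₗ[K] (Fin k → K) :=
    LinearMap.pi fun j => (Polynomial.lcoeff K (j : ℕ)).comp ((Polynomial.taylor 1).comp F)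
  have hT : LinearMap.ker T ≠ ⊥ := by
    apply LinearMap.ker_ne_bot_of_finrank_lt
    simp [hE]
  obtain ⟨c, hc, hc0⟩ := (Submodule.ne_bot_iff _).1 hT
  have hcoe : ∀ i : E, (F c).coeff i = c i := by
    intro i
    rw [hF, Polynomial.finsetSum_coeff, Finset.sum_eq_single i]
    · simp
    · intro b _ hb
      rw [Polynomial.coeff_monomial, if_neg]
      exact fun h => hb (Subtype.ext h)
    · simp
  have hs : (F c).support ⊆ E := by
    intro x hx
    by_contra hxE
    rw [Polynomial.mem_support_iff, hF, Polynomial.finsetSum_coeff] at hx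
    apply hx
    apply Finset.sum_eq_zero
    intro i _
    rw [Polynomial.coeff_monomial, if_neg]
    rintro rfl
    exact hxE i.2
  have hd : (Polynomial.X - Polynomial.C 1) ^ k ∣ F c := by
    rw [Polynomial.X_sub_C_pow_dvd_iff, Polynomial.X_pow_dvd_iff]
    intro d hd
    have := congrFun (LinearMap.mem_ker.1 hc) ⟨d, hd⟩
    simpa [T, Polynomial.taylor_apply] using this
  refine ⟨F c, hs, hd, fun h0 => hc0 ?_⟩
  have : F c = 0 := by
    apply sparse_zero k _ _ hd
    have : (F c).support ⊆ E.erase e := by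
      intro x hx
      rw [Finset.mem_erase]
      refine ⟨?_, hs hx⟩
      rintro rfl
      exact (Polynomial.mem_support_iff.1 hx) h0
    have := Finset.card_le_card this
    rw [Finset.card_erase_of_mem he] at this
    omega
  ext i
  rw [← hcoe i, this]; simp

theorem split_poly {K : Type} [Field K] (n a : ℕ) (hna : n < a) (f : Polynomial K)
    (hf : f.support ⊆ Finset.range (n + 1) ∪ Finset.Ico a (a + n + 1)) :
    ∃ A B : Polynomial K, A.natDegree ≤ n ∧ B.natDegree ≤ n ∧ f = B - Polynomial.X ^ a * A ∧
      A.coeff n = - f.coeff (a + n) ∧ B.coeff n = f.coeff n := by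
  let B : Polynomial K := ∑ i ∈ Finset.range (n + 1), Polynomial.monomial i (f.coeff i)
  let A : Polynomial K := ∑ i ∈ Finset.range (n + 1), Polynomial.monomial i (-f.coeff (a + i))
  have hB : ∀ j, B.coeff j = if j < n + 1 then f.coeff j else 0 := by
    intro j; simp only [B, Polynomial.finsetSum_coeff, Polynomial.coeff_monomial, Finset.sum_ite_eq', Finset.mem_range]
  have hA : ∀ j, A.coeff j = if j < n + 1 then - f.coeff (a + j) else 0 := by
    intro j; simp only [A, Polynomial.finsetSum_coeff, Polynomial.coeff_monomial, Finset.sum_ite_eq', Finset.mem_range]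
  refine ⟨A, B, ?_, ?_, ?_, ?_, ?_⟩
  · rw [Polynomial.natDegree_le_iff_coeff_eq_zero]
    intro N hN; rw [hA, if_neg (by omega)]
  · rw [Polynomial.natDegree_le_iff_coeff_eq_zero]
    intro N hN; rw [hB, if_neg (by omega)]
  · ext j
    rw [Polynomial.coeff_sub, Polynomial.coeff_X_pow_mul', hB, hA]
    have hz : j ∉ Finset.range (n + 1) ∪ Finset.Ico a (a + n + 1) → f.coeff j = 0 := by
      intro h
      by_contra h'
      exact h (hf (Polynomial.mem_support_iff.2 h'))
    simp only [Finset.mem_union, Finset.mem_range, Finset.mem_Ico] at hz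
    split_ifs with h1 h2 h3 h4 h5
    · omega
    · omega
    · simp
    · rw [Nat.add_sub_cancel' h4]; simp
    · rw [hz (by omega)]; simp
    · rw [hz (by omega)]; simp
  · rw [hA, if_pos (by omega)]
  · rw [hB, if_pos (by omega)]

theorem uni_basis {K : Type} [Field K] [CharZero K] (n a : ℕ) (hna : n < a) :
    ∃ (A₁ B₁ A₂ B₂ : Polynomial K) (c : K), A₁.natDegree ≤ n ∧ B₁.natDegree ≤ n ∧
      A₂.natDegree ≤ n ∧ B₂.natDegree ≤ n ∧ c ≠ 0 ∧
      (Polynomial.X - Polynomial.C 1) ^ (2 * n) ∣ B₁ - Polynomial.X ^ a * A₁ ∧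
      (Polynomial.X - Polynomial.C 1) ^ (2 * n) ∣ B₂ - Polynomial.X ^ a * A₂ ∧
      A₁ * B₂ - A₂ * B₁ = Polynomial.C c * (Polynomial.X - Polynomial.C 1) ^ (2 * n) := by
  obtain ⟨f₁, hs₁, hd₁, hc₁⟩ := exists_sparse (K := K) (2 * n)
    (Finset.range n ∪ Finset.Ico a (a + n + 1)) (by
      rw [Finset.card_union_of_disjoint]
      · simp; omega
      · rw [Finset.disjoint_left]; intro x; simp; omega) (a + n) (by simp)
  obtain ⟨f₂, hs₂, hd₂, hc₂⟩ := exists_sparse (K := K) (2 * n)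
    (Finset.range (n + 1) ∪ Finset.Ico a (a + n)) (by
      rw [Finset.card_union_of_disjoint]
      · simp; omega
      · rw [Finset.disjoint_left]; intro x; simp; omega) n (by simp)
  obtain ⟨A₁, B₁, hA₁, hB₁, e₁, ca₁, cb₁⟩ := split_poly n a hna f₁ (hs₁.trans (by
    intro x; simp; omega))
  obtain ⟨A₂, B₂, hA₂, hB₂, e₂, ca₂, cb₂⟩ := split_poly n a hna f₂ (hs₂.trans (by
    intro x; simp; omega))
  have z₁ : B₁.coeff n = 0 := by
    rw [cb₁]; by_contra h
    have := hs₁ (Polynomial.mem_support_iff.2 h)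
    simp at this; omega
  have hcn : (A₁ * B₂ - A₂ * B₁).coeff (n + n) ≠ 0 := by
    rw [Polynomial.coeff_sub, Polynomial.coeff_mul_add_eq_of_natDegree_le hA₁ hB₂,
      Polynomial.coeff_mul_add_eq_of_natDegree_le hA₂ hB₁, z₁, ca₁, cb₂]
    simp [hc₁, hc₂]
  have hdeg : (A₁ * B₂ - A₂ * B₁).natDegree ≤ 2 * n := by
    refine (Polynomial.natDegree_sub_le _ _).trans (max_le ?_ ?_)
    · exact Polynomial.natDegree_mul_le.trans (by omega)
    · exact Polynomial.natDegree_mul_le.trans (by omega)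
  have hdvd : (Polynomial.X - Polynomial.C 1) ^ (2 * n) ∣ A₁ * B₂ - A₂ * B₁ := by
    have : A₁ * B₂ - A₂ * B₁ = A₁ * f₂ - A₂ * f₁ := by rw [e₁, e₂]; ring
    rw [this]
    exact dvd_sub (hd₂.mul_left _) (hd₁.mul_left _)
  obtain ⟨u, hu⟩ := hdvd
  have hmon : ((Polynomial.X - Polynomial.C (1 : K)) ^ (2 * n)).Monic :=
    (Polynomial.monic_X_sub_C _).pow _
  have hu0 : u ≠ 0 := by rintro rfl; rw [hu] at hcn; simp at hcn
  have hud : u.natDegree = 0 := by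
    rw [hu, hmon.natDegree_mul' hu0] at hdeg
    rw [natDegree_lin_pow] at hdeg; omega
  rw [Polynomial.natDegree_eq_zero] at hud
  obtain ⟨c, rfl⟩ := hud
  refine ⟨A₁, B₁, A₂, B₂, c, hA₁, hB₁, hA₂, hB₂, ?_, e₁ ▸ hd₁, e₂ ▸ hd₂, by rw [hu]; ring⟩
  rintro rfl; simp at hu0

/-- homogenization in two elements -/
noncomputable def hmg {K R : Type} [Field K] [CommRing R] [Algebra K R] (y z : R)
    (p : Polynomial K) (N : ℕ) : R :=
  aeval ![y, z] (p.homogenize N)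

theorem hmg_mul {K R : Type} [Field K] [CommRing R] [Algebra K R] (y z : R)
    (p r : Polynomial K) (M N : ℕ) (hp : p.natDegree ≤ M) (hr : r.natDegree ≤ N) :
    hmg y z (p * r) (M + N) = hmg y z p M * hmg y z r N := by
  simp [hmg, Polynomial.homogenize_mul p r hp hr]

theorem hmg_sub {K R : Type} [Field K] [CommRing R] [Algebra K R] (y z : R)
    (p r : Polynomial K) (N : ℕ) :
    hmg y z (p - r) N = hmg y z p N - hmg y z r N := by
  simp [hmg]

theorem hmg_X_pow {K R : Type} [Field K] [CommRing R] [Algebra K R] (y z : R) (N : ℕ) :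
    hmg y z (Polynomial.X ^ N : Polynomial K) N = y ^ N := by
  simp [hmg]

theorem hmg_one {K R : Type} [Field K] [CommRing R] [Algebra K R] (y z : R) (N : ℕ) :
    hmg y z (1 : Polynomial K) N = z ^ N := by
  simp [hmg]

theorem hmg_lin_pow {K R : Type} [Field K] [CommRing R] [Algebra K R] (y z : R) (N : ℕ) :
    hmg y z ((Polynomial.X - Polynomial.C 1) ^ N : Polynomial K) N = (y - z) ^ N := by
  induction N with
  | zero => simp [hmg]
  | succ N ih =>
    rw [pow_succ, hmg_mul _ _ _ _ _ _ (natDegree_lin_pow N).le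
      (Polynomial.natDegree_X_sub_C _).le, ih, pow_succ]
    congr 1
    simp [hmg]

theorem hmg_dvd {K R : Type} [Field K] [CommRing R] [Algebra K R] (y z : R) (n a : ℕ)
    (hna : n ≤ a) (A B : Polynomial K) (hA : A.natDegree ≤ n) (hB : B.natDegree ≤ n)
    (hd : (Polynomial.X - Polynomial.C 1) ^ (2 * n) ∣ B - Polynomial.X ^ a * A) :
    (y - z) ^ (2 * n) ∣ z ^ a * hmg y z B n - y ^ a * hmg y z A n := by
  have h1 : z ^ a * hmg y z B n - y ^ a * hmg y z A n
      = hmg y z (B - Polynomial.X ^ a * A) (a + n) := by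
    rw [hmg_sub, hmg_mul _ _ _ _ _ _ (by simp) hA, hmg_X_pow, ← hmg_one (K := K) y z a,
      ← hmg_mul _ _ _ _ _ _ (by simp) hB, one_mul]
  obtain ⟨u, hu⟩ := hd
  rw [h1]
  have hmon : ((Polynomial.X - Polynomial.C (1 : K)) ^ (2 * n)).Monic :=
    (Polynomial.monic_X_sub_C _).pow _
  by_cases hu0 : u = 0
  · rw [hu, hu0]; simp [hmg]
  · have hdeg : (B - Polynomial.X ^ a * A).natDegree ≤ a + n := by
      refine (Polynomial.natDegree_sub_le _ _).trans (max_le (by omega) ?_)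
      exact Polynomial.natDegree_mul_le.trans (by simp; omega)
    rw [hu, hmon.natDegree_mul' hu0] at hdeg
    rw [natDegree_lin_pow] at hdeg
    rw [hu, show a + n = 2 * n + (a - n) by omega, hmg_mul _ _ _ _ _ _ (natDegree_lin_pow _).le (by omega),
      hmg_lin_pow]
    exact dvd_mul_right _ _

theorem prime_lin {K : Type} [Field K] (i j : Fin 3) (h : i ≠ j) :
    Prime (X i - X j : MvPolynomial (Fin 3) K) := by
  let φ : MvPolynomial (Fin 3) K →ₐ[K] MvPolynomial (Fin 3) K :=
    aeval (fun k => if k = i then X i + X j else X k)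
  let ψ : MvPolynomial (Fin 3) K →ₐ[K] MvPolynomial (Fin 3) K :=
    aeval (fun k => if k = i then X i - X j else X k)
  let e : MvPolynomial (Fin 3) K ≃ₐ[K] MvPolynomial (Fin 3) K :=
    AlgEquiv.ofAlgHom φ ψ
      (by
        ext k : 1
        by_cases hk : k = i
        · subst hk; simp [φ, ψ, h.symm]
        · simp [φ, ψ, hk])
      (by
        ext k : 1
        by_cases hk : k = i
        · subst hk; simp [φ, ψ, h.symm]
        · simp [φ, ψ, hk])
  have h1 : e (X i - X j) = X i := by
    simp [e, φ, h.symm]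
  rw [← MulEquiv.prime_iff e.toMulEquiv]
  show Prime (e (X i - X j))
  rw [h1]
  exact MvPolynomial.X_prime

/-- The mixed multiplicity in rank 2: the multiarrangement on the type `A₂` Coxeter
arrangement in `K³` with defining polynomial `(x₁-x₂)^{m+q}(x₁-x₃)^{m+q}(x₂-x₃)^m`, `m` even,
is free with homogeneous basis of degrees `{0, 3m/2 + q, 3m/2 + q}`, the degree-0 element
being the invariant direction `∂₁ + ∂₂ + ∂₃`. -/
theorem stmt15 {K : Type} [Field K] [CharZero K] (m q : ℕ) (hm : 1 ≤ m) (hme : Even m)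
    (hq : 1 ≤ q) :
    ∃ θ : Fin 3 → Fin 3 → MvPolynomial (Fin 3) K,
      isBasisOf (fun f =>
          (X 0 - X 1 : MvPolynomial (Fin 3) K) ^ (m + q) ∣ f 0 - f 1 ∧
          (X 0 - X 2 : MvPolynomial (Fin 3) K) ^ (m + q) ∣ f 0 - f 2 ∧
          (X 1 - X 2 : MvPolynomial (Fin 3) K) ^ m ∣ f 1 - f 2) θ ∧
      θ 0 = (fun _ => (1 : MvPolynomial (Fin 3) K)) ∧
      homogOf (θ 0) 0 ∧ homogOf (θ 1) (3 * m / 2 + q) ∧ homogOf (θ 2) (3 * m / 2 + q) := by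
  obtain ⟨n, rfl⟩ := hme
  obtain ⟨A₁, B₁, A₂, B₂, c, hA₁, hB₁, hA₂, hB₂, hc, hd₁, hd₂, hdet⟩ :=
    uni_basis (K := K) n (n + n + q) (by omega)
  obtain ⟨a, ha⟩ : ∃ a, a = n + n + q := ⟨_, rfl⟩
  rw [← ha] at hd₁ hd₂ ⊢
  obtain ⟨y, hy⟩ : ∃ y : MvPolynomial (Fin 3) K, y = X 0 - X 1 := ⟨_, rfl⟩
  obtain ⟨z, hz⟩ : ∃ z : MvPolynomial (Fin 3) K, z = X 0 - X 2 := ⟨_, rfl⟩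
  obtain ⟨w, hw⟩ : ∃ w : MvPolynomial (Fin 3) K, w = X 1 - X 2 := ⟨_, rfl⟩
  have hwyz : w = z - y := by rw [hw, hy, hz]; ring
  have hy0 : y ≠ 0 := hy ▸ (prime_lin 0 1 (by decide)).ne_zero
  have hz0 : z ≠ 0 := hz ▸ (prime_lin 0 2 (by decide)).ne_zero
  have hwp : Prime w := hw ▸ prime_lin 1 2 (by decide)
  have hwz : ¬ w ∣ z := by
    rintro ⟨u, hu⟩
    have := congrArg (MvPolynomial.eval (![1, 0, 0] : Fin 3 → K)) hu
    simp [hw, hz] at this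
  have hyh : y.IsHomogeneous 1 := hy ▸ (isHomogeneous_X K 0).sub (isHomogeneous_X K 1)
  have hzh : z.IsHomogeneous 1 := hz ▸ (isHomogeneous_X K 0).sub (isHomogeneous_X K 2)
  have hhom : ∀ p : Polynomial K, (hmg y z p n).IsHomogeneous n := by
    intro p
    have := (Polynomial.isHomogeneous_homogenize (n := n) p).aeval ![y, z] (n := 1) (by
      intro i; fin_cases i <;> simpa)
    simpa [hmg] using this
  have hpow : (y - z) ^ (2 * n) = w ^ (n + n) := by
    rw [hwyz, ← two_mul, ← neg_sub z y, Even.neg_pow (even_two_mul n)]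
  have D₁ := hmg_dvd y z n a (by omega) A₁ B₁ hA₁ hB₁ hd₁
  have D₂ := hmg_dvd y z n a (by omega) A₂ B₂ hA₂ hB₂ hd₂
  have hCm : ∀ (p : Polynomial K) (N : ℕ),
      hmg y z (Polynomial.C c * p) N = C c * hmg y z p N := by
    intro p N
    rw [hmg, Polynomial.homogenize_C_mul, map_mul, aeval_C, algebraMap_eq, hmg]
  have hΔ : hmg y z A₁ n * hmg y z B₂ n - hmg y z A₂ n * hmg y z B₁ n
      = C c * w ^ (n + n) := by
    rw [← hmg_mul _ _ _ _ _ _ hA₁ hB₂, ← hmg_mul _ _ _ _ _ _ hA₂ hB₁, ← hmg_sub, hdet, ← hpow,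
      two_mul, hCm, hmg_lin_pow]
  rw [hpow] at D₁ D₂
  have hh₁ := hhom A₁
  have hh₂ := hhom A₂
  have hh₃ := hhom B₁
  have hh₄ := hhom B₂
  generalize hmg y z A₁ n = P₁ at *
  generalize hmg y z B₁ n = Q₁ at *
  generalize hmg y z A₂ n = P₂ at *
  generalize hmg y z B₂ n = Q₂ at *
  have hC0 : (C c : MvPolynomial (Fin 3) K) ≠ 0 := by simpa using hc
  have hcc : (C c⁻¹ : MvPolynomial (Fin 3) K) * C c = 1 := by
    rw [← C_mul, inv_mul_cancel₀ hc, C_1]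
  have hW0 : w ^ (n + n) ≠ 0 := pow_ne_zero _ hwp.ne_zero
  rw [← hy, ← hz, ← hw]
  generalize hWd : w ^ (n + n) = W at *
  have hcop : ∀ t, W ∣ z ^ a * t → W ∣ t := by
    intro t ht
    rw [← hWd] at ht ⊢
    exact hwp.pow_dvd_of_dvd_mul_left _ (fun h => hwz (hwp.dvd_of_dvd_pow h)) ht
  have hdeg : 3 * (n + n) / 2 + q = 1 * a + n := by omega
  rw [hdeg]
  refine ⟨![fun _ => 1, ![0, -(y ^ a * P₁), -(z ^ a * Q₁)], ![0, -(y ^ a * P₂), -(z ^ a * Q₂)]],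
    ⟨?_, ?_⟩, rfl, ?_, ?_, ?_⟩
  · intro j
    fin_cases j
    · simp
    · refine ⟨by simp, by simp, ?_⟩
      convert D₁ using 1
      simp; ring
    · refine ⟨by simp, by simp, ?_⟩
      convert D₂ using 1
      simp; ring
  · rintro g ⟨⟨A, hA⟩, ⟨B, hB⟩, hg⟩
    have hg12 : g 1 - g 2 = z ^ a * B - y ^ a * A := by rw [← hA, ← hB]; ring
    rw [hg12] at hg
    obtain ⟨u, hu⟩ := hcop (A * Q₂ - P₂ * B) (by
      have : z ^ a * (A * Q₂ - P₂ * B)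
        = A * (z ^ a * Q₂ - y ^ a * P₂) - P₂ * (z ^ a * B - y ^ a * A) := by ring
      rw [this]; exact dvd_sub (D₂.mul_left _) (hg.mul_left _))
    obtain ⟨v, hv⟩ := hcop (P₁ * B - A * Q₁) (by
      have : z ^ a * (P₁ * B - A * Q₁)
        = P₁ * (z ^ a * B - y ^ a * A) - A * (z ^ a * Q₁ - y ^ a * P₁) := by ring
      rw [this]; exact dvd_sub (hg.mul_left _) (D₁.mul_left _))
    have hCW : C c * W ≠ 0 := mul_ne_zero hC0 hW0
    have eA : A = C c⁻¹ * u * P₁ + C c⁻¹ * v * P₂ := by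
      apply mul_left_cancel₀ hCW
      linear_combination (-A) * hΔ + P₁ * hu + P₂ * hv - (W * u * P₁ + W * v * P₂) * hcc
    have eB : B = C c⁻¹ * u * Q₁ + C c⁻¹ * v * Q₂ := by
      apply mul_left_cancel₀ hCW
      linear_combination (-B) * hΔ + Q₁ * hu + Q₂ * hv - (W * u * Q₁ + W * v * Q₂) * hcc
    have e1 : g 1 = g 0 - y ^ a * A := by rw [← hA]; ring
    have e2 : g 2 = g 0 - z ^ a * B := by rw [← hB]; ring
    refine ⟨![g 0, C c⁻¹ * u, C c⁻¹ * v], ?_, ?_⟩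
    · ext1 i
      fin_cases i
      · simp [Fin.sum_univ_three]
      · simp [Fin.sum_univ_three]
        rw [e1]; linear_combination (-y ^ a) * eA
      · simp [Fin.sum_univ_three]
        rw [e2]; linear_combination (-z ^ a) * eB
    · intro d hd
      have k0 := congrFun hd 0
      have k1 := congrFun hd 1
      have k2 := congrFun hd 2
      simp [Fin.sum_univ_three] at k0 k1 k2
      have fA : A = d 1 * P₁ + d 2 * P₂ := by
        apply mul_left_cancel₀ (pow_ne_zero a hy0)
        linear_combination e1 - k1 + k0
      have fB : B = d 1 * Q₁ + d 2 * Q₂ := by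
        apply mul_left_cancel₀ (pow_ne_zero a hz0)
        linear_combination e2 - k2 + k0
      have r1 : d 1 = C c⁻¹ * u := by
        apply mul_left_cancel₀ hCW
        linear_combination (-d 1) * hΔ - Q₂ * fA + P₂ * fB + hu - W * u * hcc
      have r2 : d 2 = C c⁻¹ * v := by
        apply mul_left_cancel₀ hCW
        linear_combination (-d 2) * hΔ + Q₁ * fA - P₁ * fB + hv - W * v * hcc
      ext1 i
      fin_cases i
      · exact k0.symm
      · exact r1
      · exact r2
  · intro i; right; exact isHomogeneous_one _ _
  · intro i
    fin_cases i
    · left; rfl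
    · right; exact ((hyh.pow a).mul hh₁).neg
    · right; exact ((hzh.pow a).mul hh₃).neg
  · intro i
    fin_cases i
    · left; rfl
    · right; exact ((hyh.pow a).mul hh₂).neg
    · right; exact ((hzh.pow a).mul hh₄).neg
end
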